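/- arXiv:1011.0672 — 3 statements merged into one kernel-verified Lean document; each statement's English description precedes it below -/
import Mathlib

section
/- Let E, F ⊆ ℤ be two regular compatible sets. Then for Lebesgue almost every λ ∈ ℝ, the counting dimension of the arithmetic sum satisfies D(E + ⌊λF⌋) ≥ min{1, D(E) + D(F)}, where E + ⌊λF⌋ = {a + ⌊λb⌋ : a ∈ E, b ∈ F}. -/
open Filter MeasureTheory
open scoped ENNReal

noncomputable section

/-- The filter of intervals `(M, N]` of `ℤ` as the length `N - M` tends to infinity.
An interval is encoded by the pair `(M, N)`. -/
def intervalFilter : Filter (ℤ × ℤ) :=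
  Filter.comap (fun p : ℤ × ℤ => p.2 - p.1) Filter.atTop

/-- The number of elements of `E` in the interval `(M, N]`. -/
def icount (E : Set ℤ) (M N : ℤ) : ℕ := (E ∩ Set.Ioc M N).ncard

/-- The counting dimension of `E ⊆ ℤ`:
`D(E) = limsup_{|I| → ∞} log |E ∩ I| / log |I|`. -/
def countingDim (E : Set ℤ) : ℝ :=
  Filter.limsup
    (fun p : ℤ × ℤ => Real.log (icount E p.1 p.2) / Real.log ((p.2 - p.1 : ℤ) : ℝ))
    intervalFilter

/-- The counting `α`-measure of `E ⊆ ℤ`: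
`H_α(E) = limsup_{|I| → ∞} |E ∩ I| / |I|^α`, with values in `[0, ∞]`. -/
def countingMeasure (α : ℝ) (E : Set ℤ) : ℝ≥0∞ :=
  Filter.limsup
    (fun p : ℤ × ℤ =>
      ENNReal.ofReal ((icount E p.1 p.2 : ℝ) / ((p.2 - p.1 : ℤ) : ℝ) ^ α))
    intervalFilter

/-- The upper-Banach density of `E ⊆ ℤ`:
`d*(E) = limsup_{|I| → ∞} |E ∩ I| / |I|`. -/
def upperBanach (E : Set ℤ) : ℝ :=
  Filter.limsup
    (fun p : ℤ × ℤ => (icount E p.1 p.2 : ℝ) / ((p.2 - p.1 : ℤ) : ℝ))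
    intervalFilter

/-- `E ⊆ ℤ` is regular if `0 < H_{D(E)}(E) < ∞`. -/
def Regular (E : Set ℤ) : Prop :=
  0 < countingMeasure (countingDim E) E ∧ countingMeasure (countingDim E) E < ⊤

/-- Two (regular) sets `E, F ⊆ ℤ` are compatible if there are sequences of intervals
`I_n = (a n, b n]`, `J_n = (c n, d n]` with increasing lengths, `|I_n| ≍ |J_n|`,
`|E ∩ I_n| ≫ |I_n|^{D(E)}` and `|F ∩ J_n| ≫ |J_n|^{D(F)}`. -/
def Compatible (E F : Set ℤ) : Prop :=
  ∃ a b c d : ℕ → ℤ,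
    (∀ n, a n < b n) ∧ (∀ n, c n < d n) ∧
    StrictMono (fun n => b n - a n) ∧ StrictMono (fun n => d n - c n) ∧
    (∃ C : ℝ, 0 < C ∧ ∀ n,
      ((b n - a n : ℤ) : ℝ) ≤ C * ((d n - c n : ℤ) : ℝ) ∧
      ((d n - c n : ℤ) : ℝ) ≤ C * ((b n - a n : ℤ) : ℝ)) ∧
    (∃ c₁ : ℝ, 0 < c₁ ∧ ∀ n,
      c₁ * ((b n - a n : ℤ) : ℝ) ^ countingDim E ≤ (icount E (a n) (b n) : ℝ)) ∧
    (∃ c₂ : ℝ, 0 < c₂ ∧ ∀ n,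
      c₂ * ((d n - c n : ℤ) : ℝ) ^ countingDim F ≤ (icount F (c n) (d n) : ℝ))

/-- The arithmetic sum `E + ⌊λ F⌋ = {a + ⌊λ b⌋ : a ∈ E, b ∈ F}`. -/
def sumFloor (E F : Set ℤ) (l : ℝ) : Set ℤ :=
  {n : ℤ | ∃ a ∈ E, ∃ b ∈ F, n = a + ⌊l * (b : ℝ)⌋}

lemma Set.Ioc_inter_finite (E : Set ℤ) (M N : ℤ) : (E ∩ Set.Ioc M N).Finite :=
  (Set.finite_Ioc M N).subset Set.inter_subset_right

lemma card_le_icount {E : Set ℤ} {M N : ℤ} {S : Finset ℤ}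
    (hS : ∀ x ∈ S, x ∈ E ∧ M < x ∧ x ≤ N) : S.card ≤ icount E M N := by
  rw [icount, ← Set.ncard_coe_finset]
  exact Set.ncard_le_ncard (fun x hx => ⟨(hS x hx).1, (hS x hx).2⟩) (Set.Ioc_inter_finite E M N)

lemma icount_le_length (E : Set ℤ) {M N : ℤ} (h : M ≤ N) :
    (icount E M N : ℝ) ≤ ((N - M : ℤ) : ℝ) := by
  have h1 : icount E M N ≤ (N - M).toNat := by
    rw [← Int.card_Ioc, ← Set.ncard_coe_finset, Finset.coe_Ioc]
    exact Set.ncard_le_ncard Set.inter_subset_right (Set.finite_Ioc M N)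
  have h2 : ((icount E M N : ℕ) : ℤ) ≤ N - M := by omega
  exact_mod_cast h2

lemma eventually_intervalFilter {P : ℤ × ℤ → Prop} :
    (∀ᶠ p in intervalFilter, P p) ↔ ∃ L : ℤ, ∀ p : ℤ × ℤ, L ≤ p.2 - p.1 → P p := by
  rw [intervalFilter, Filter.eventually_comap, Filter.eventually_atTop]
  constructor
  · rintro ⟨L, hL⟩
    exact ⟨L, fun p hp => hL _ hp p rfl⟩
  · rintro ⟨L, hL⟩
    exact ⟨L, fun l hl p hp => hL p (hp ▸ hl)⟩

lemma logRatio_mem (E : Set ℤ) {p : ℤ × ℤ} (hp : 2 ≤ p.2 - p.1) :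
    0 ≤ Real.log (icount E p.1 p.2) / Real.log ((p.2 - p.1 : ℤ) : ℝ) ∧
    Real.log (icount E p.1 p.2) / Real.log ((p.2 - p.1 : ℤ) : ℝ) ≤ 1 := by
  have h2 : (2 : ℝ) ≤ ((p.2 - p.1 : ℤ) : ℝ) := by exact_mod_cast hp
  have hlog : 0 < Real.log ((p.2 - p.1 : ℤ) : ℝ) := Real.log_pos (by linarith)
  refine ⟨div_nonneg (Real.log_natCast_nonneg _) hlog.le, (div_le_one hlog).2 ?_⟩
  rcases Nat.eq_zero_or_pos (icount E p.1 p.2) with h0 | h0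
  · rw [h0]; simpa using hlog.le
  · exact Real.log_le_log (by exact_mod_cast h0) (icount_le_length E (by omega))

lemma isBoundedUnder_logRatio (E : Set ℤ) :
    intervalFilter.IsBoundedUnder (· ≤ ·)
      (fun p : ℤ × ℤ => Real.log (icount E p.1 p.2) / Real.log ((p.2 - p.1 : ℤ) : ℝ)) :=
  ⟨1, Filter.eventually_map.2 <|
    eventually_intervalFilter.2 ⟨2, fun _ hp => (logRatio_mem E hp).2⟩⟩

instance neBot_intervalFilter : intervalFilter.NeBot := by
  refine Filter.neBot_iff.2 fun h => ?_
  have h1 : ∀ᶠ p in intervalFilter, False := by rw [h]; trivial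
  obtain ⟨L, hL⟩ := eventually_intervalFilter.1 h1
  exact hL (0, L) (by simp)

/-- A lower bound for the counting dimension from arbitrarily long intervals on which the set
is large. -/
lemma le_countingDim_of_long_intervals {E : Set ℤ} {δ : ℝ}
    (h : ∀ L : ℤ, ∃ M N : ℤ, L ≤ N - M ∧ ((N - M : ℤ) : ℝ) ^ δ ≤ icount E M N) :
    δ ≤ countingDim E := by
  refine Filter.le_limsup_of_frequently_le ?_ (isBoundedUnder_logRatio E)
  intro hev
  obtain ⟨L, hL⟩ := eventually_intervalFilter.1 hev
  obtain ⟨M, N, hMN, hcount⟩ := h (max L 2)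
  refine hL (M, N) (le_trans (le_max_left _ _) hMN) ?_
  have h2 : (2 : ℝ) ≤ ((N - M : ℤ) : ℝ) := by exact_mod_cast le_trans (le_max_right L 2) hMN
  have hlog : 0 < Real.log ((N - M : ℤ) : ℝ) := Real.log_pos (by linarith)
  change δ ≤ Real.log (icount E M N) / Real.log ((N - M : ℤ) : ℝ)
  rw [le_div_iff₀ hlog, ← Real.log_rpow (by linarith)]
  exact Real.log_le_log (Real.rpow_pos_of_pos (by linarith) _) hcount

lemma countingDim_nonneg (E : Set ℤ) : 0 ≤ countingDim E := by
  refine Filter.le_limsup_of_frequently_le ?_ (isBoundedUnder_logRatio E)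
  exact (eventually_intervalFilter.2 ⟨2, fun _ hp => (logRatio_mem E hp).1⟩).frequently

/-- A set of finite counting `α`-measure has at most `C |I| ^ α` points in every interval `I`. -/
lemma exists_icount_le {E : Set ℤ} {α : ℝ} (hα : 0 ≤ α) (h : countingMeasure α E < ⊤) :
    ∃ C : ℝ, 0 < C ∧ ∀ M N : ℤ, M < N → (icount E M N : ℝ) ≤ C * ((N - M : ℤ) : ℝ) ^ α := by
  obtain ⟨c, hc, hc'⟩ := exists_between h
  obtain ⟨L, hL⟩ := eventually_intervalFilter.1 (Filter.eventually_lt_of_limsup_lt hc)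
  refine ⟨max (max c.toReal L) 1, by positivity, fun M N hMN => ?_⟩
  have h1 : (1 : ℝ) ≤ ((N - M : ℤ) : ℝ) := by exact_mod_cast (by omega : 1 ≤ N - M)
  have hpow : (1 : ℝ) ≤ ((N - M : ℤ) : ℝ) ^ α := Real.one_le_rpow h1 hα
  rcases le_or_gt L (N - M) with hlen | hlen
  · have h3 := (ENNReal.ofReal_lt_iff_lt_toReal (by positivity) hc'.ne).1 (hL (M, N) hlen)
    have h4 := ((div_lt_iff₀ (by positivity)).1 h3).le
    refine h4.trans (mul_le_mul_of_nonneg_right ?_ (by positivity))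
    exact le_max_of_le_left (le_max_left _ _)
  · calc (icount E M N : ℝ) ≤ ((N - M : ℤ) : ℝ) := icount_le_length E hMN.le
      _ ≤ L := by exact_mod_cast hlen.le
      _ ≤ max (max c.toReal L) 1 := le_max_of_le_left (le_max_right _ _)
      _ ≤ _ := le_mul_of_one_le_right (by positivity) hpow

/-- A finite piece of a set with at most `C |I| ^ t` points in each interval has logarithmic
`t`-energy. -/
lemma sum_natAbs_rpow_neg_le {F : Set ℤ} {t C : ℝ} (ht : 0 ≤ t)
    (hF : ∀ M N : ℤ, M < N → (icount F M N : ℝ) ≤ C * ((N - M : ℤ) : ℝ) ^ t)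
    {B : Finset ℤ} (hB : ∀ x ∈ B, x ∈ F) {L : ℕ} (b : ℤ) (hb : ∀ x ∈ B, (x - b).natAbs ≤ L) :
    ∑ x ∈ B with x ≠ b, ((x - b).natAbs : ℝ) ^ (-t) ≤ C * 4 ^ t * (Nat.log 2 L + 1) := by
  have hmaps : ∀ x ∈ B.filter (· ≠ b), Nat.log 2 (x - b).natAbs ∈ Finset.range (Nat.log 2 L + 1) := by
    intro x hx
    rw [Finset.mem_range, Nat.lt_succ_iff]
    exact Nat.log_mono_right (hb x (Finset.mem_filter.1 hx).1)
  rw [← Finset.sum_fiberwise_of_maps_to hmaps]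
  have hfib : ∀ k ∈ Finset.range (Nat.log 2 L + 1),
      ∑ x ∈ (B.filter (· ≠ b)).filter (fun x => Nat.log 2 (x - b).natAbs = k),
        ((x - b).natAbs : ℝ) ^ (-t) ≤ C * 4 ^ t := by
    intro k _
    set S := (B.filter (· ≠ b)).filter (fun x => Nat.log 2 (x - b).natAbs = k) with hS
    have hbd : ∀ x ∈ S, 2 ^ k ≤ (x - b).natAbs ∧ (x - b).natAbs < 2 ^ (k + 1) := by
      intro x hx
      simp only [hS, Finset.mem_filter] at hx
      obtain ⟨⟨-, hne⟩, rfl⟩ := hx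
      exact ⟨Nat.pow_log_le_self 2 (by omega), Nat.lt_pow_succ_log_self (by norm_num) _⟩
    have hcard : (S.card : ℝ) ≤ C * (2 ^ k * 4) ^ t := by
      have h1 : S.card ≤ icount F (b - 2 ^ (k + 1)) (b + 2 ^ (k + 1)) := by
        refine card_le_icount fun x hx => ⟨hB x ?_, ?_⟩
        · exact (Finset.mem_filter.1 (Finset.mem_filter.1 hx).1).1
        · have h2 := (hbd x hx).2
          have h3 : ((x - b).natAbs : ℤ) < 2 ^ (k + 1) := by exact_mod_cast h2
          omega
      have h2 := hF (b - 2 ^ (k + 1)) (b + 2 ^ (k + 1))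
        (by have : (0 : ℤ) < 2 ^ (k + 1) := by positivity
            omega)
      calc (S.card : ℝ) ≤ icount F (b - 2 ^ (k + 1)) (b + 2 ^ (k + 1)) := by exact_mod_cast h1
        _ ≤ _ := h2
        _ = _ := by
          congr 2
          push_cast
          ring
    calc ∑ x ∈ S, ((x - b).natAbs : ℝ) ^ (-t) ≤ ∑ x ∈ S, ((2 : ℝ) ^ k) ^ (-t) := by
          refine Finset.sum_le_sum fun x hx => ?_
          refine Real.rpow_le_rpow_of_nonpos (by positivity) ?_ (by linarith)
          exact_mod_cast (hbd x hx).1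
      _ = S.card * ((2 : ℝ) ^ k) ^ (-t) := by rw [Finset.sum_const, nsmul_eq_mul]
      _ ≤ C * (2 ^ k * 4) ^ t * ((2 : ℝ) ^ k) ^ (-t) := by gcongr
      _ = C * 4 ^ t := by
          rw [Real.mul_rpow (by positivity) (by norm_num), Real.rpow_neg (by positivity)]
          field_simp
  refine (Finset.sum_le_sum hfib).trans_eq ?_
  simp [mul_comm]

/-- The parameters for which two points of `ℤ × ℤ` have the same image under
`(a, b) ↦ a + ⌊l b⌋`. -/
def collisionSet (x y : ℤ × ℤ) : Set ℝ :=
  {l | x.1 + ⌊l * (x.2 : ℝ)⌋ = y.1 + ⌊l * (y.2 : ℝ)⌋}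

lemma measurableSet_collisionSet (x y : ℤ × ℤ) : MeasurableSet (collisionSet x y) := by
  refine measurableSet_eq_fun ?_ ?_
  · exact (Int.measurable_floor.comp (measurable_id.mul_const _)).const_add _
  · exact (Int.measurable_floor.comp (measurable_id.mul_const _)).const_add _

lemma abs_lt_one_of_mem_collisionSet {x y : ℤ × ℤ} {l : ℝ} (h : l ∈ collisionSet x y) :
    |((y.1 - x.1 : ℤ) : ℝ) + l * ((y.2 - x.2 : ℤ) : ℝ)| < 1 := by
  have h' : ((x.1 + ⌊l * (x.2 : ℝ)⌋ : ℤ) : ℝ) = ((y.1 + ⌊l * (y.2 : ℝ)⌋ : ℤ) : ℝ) :=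
    congrArg _ h
  push_cast at h' ⊢
  have h1 := Int.floor_le (l * (x.2 : ℝ))
  have h2 := Int.lt_floor_add_one (l * (x.2 : ℝ))
  have h3 := Int.floor_le (l * (y.2 : ℝ))
  have h4 := Int.lt_floor_add_one (l * (y.2 : ℝ))
  rw [abs_lt]
  constructor <;> nlinarith

lemma volume_real_collisionSet_le {x y : ℤ × ℤ} (h : y.2 ≠ x.2) (K : ℝ) :
    (volume.restrict (Set.Icc (-K) K)).real (collisionSet x y) ≤ 2 / ((y.2 - x.2).natAbs : ℝ) := by
  have hd : ((y.2 - x.2 : ℤ) : ℝ) ≠ 0 := by exact_mod_cast sub_ne_zero.2 h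
  have hr : ((y.2 - x.2).natAbs : ℝ) = |((y.2 - x.2 : ℤ) : ℝ)| := by
    rw [Nat.cast_natAbs, Int.cast_abs]
  have hpos : 0 < |((y.2 - x.2 : ℤ) : ℝ)| := abs_pos.2 hd
  have hsub : collisionSet x y ⊆
      Metric.ball (-((y.1 - x.1 : ℤ) : ℝ) / ((y.2 - x.2 : ℤ) : ℝ)) (1 / |((y.2 - x.2 : ℤ) : ℝ)|) := by
    intro l hl
    have := abs_lt_one_of_mem_collisionSet hl
    rw [Metric.mem_ball, Real.dist_eq, lt_div_iff₀ hpos, ← abs_mul]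
    rwa [sub_mul, div_mul_cancel₀ _ hd, sub_neg_eq_add, add_comm]
  calc (volume.restrict (Set.Icc (-K) K)).real (collisionSet x y)
      ≤ volume.real (Metric.ball (-((y.1 - x.1 : ℤ) : ℝ) / ((y.2 - x.2 : ℤ) : ℝ))
          (1 / |((y.2 - x.2 : ℤ) : ℝ)|)) := by
        refine ENNReal.toReal_mono measure_ball_lt_top.ne ?_
        exact (Measure.restrict_apply_le _ _).trans (measure_mono hsub)
    _ = 2 / ((y.2 - x.2).natAbs : ℝ) := by
        rw [Real.volume_real_ball (by positivity), hr]
        ring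

lemma natAbs_le_of_mem_collisionSet {x y : ℤ × ℤ} (h : y.2 ≠ x.2) {K : ℕ} {l : ℝ}
    (hl : l ∈ Set.Icc (-(K : ℝ)) K) (hxy : l ∈ collisionSet x y) :
    (y.1 - x.1).natAbs ≤ (K + 1) * (y.2 - x.2).natAbs := by
  have h1 := abs_lt_one_of_mem_collisionSet hxy
  have h2 : |l| ≤ K := abs_le.2 hl
  have h3 : (1 : ℝ) ≤ ((y.2 - x.2).natAbs : ℝ) := by
    exact_mod_cast Int.natAbs_pos.2 (sub_ne_zero.2 h)
  have h4 : |((y.1 - x.1 : ℤ) : ℝ)| ≤ 1 + |l| * |((y.2 - x.2 : ℤ) : ℝ)| := by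
    rw [← abs_mul]
    have := abs_sub (((y.1 - x.1 : ℤ) : ℝ) + l * ((y.2 - x.2 : ℤ) : ℝ)) (l * ((y.2 - x.2 : ℤ) : ℝ))
    rw [add_sub_cancel_right] at this
    linarith
  have h5 : ((y.1 - x.1).natAbs : ℝ) ≤ (K + 1) * ((y.2 - x.2).natAbs : ℝ) := by
    rw [Nat.cast_natAbs, Int.cast_abs] at h3 ⊢
    rw [Nat.cast_natAbs, Int.cast_abs]
    nlinarith [mul_le_mul_of_nonneg_right h2 (abs_nonneg ((y.2 - x.2 : ℤ) : ℝ))]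
  exact_mod_cast h5

lemma sum_volume_real_collisionSet_le {E F : Set ℤ} {s t CE CF : ℝ} (hs : 0 ≤ s) (ht : 0 ≤ t)
    (hCE : 0 ≤ CE)
    (hE : ∀ M N : ℤ, M < N → (icount E M N : ℝ) ≤ CE * ((N - M : ℤ) : ℝ) ^ s)
    (hF : ∀ M N : ℤ, M < N → (icount F M N : ℝ) ≤ CF * ((N - M : ℤ) : ℝ) ^ t)
    {A B : Finset ℤ} (hA : ∀ a ∈ A, a ∈ E) (hB : ∀ b ∈ B, b ∈ F) {L : ℕ}
    (hBL : ∀ b ∈ B, ∀ b' ∈ B, (b' - b).natAbs ≤ L) (K : ℕ) {x : ℤ × ℤ} (hx : x ∈ A ×ˢ B) :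
    ∑ y ∈ A ×ˢ B, (volume.restrict (Set.Icc (-(K : ℝ)) K)).real (collisionSet x y) ≤
      2 * K + CE * (2 * K + 3) ^ s * 2 * (L : ℝ) ^ max 0 (s + t - 1) *
        (CF * 4 ^ t * (Nat.log 2 L + 1)) := by
  obtain ⟨hxA, hxB⟩ := Finset.mem_product.1 hx
  set μ := volume.restrict (Set.Icc (-(K : ℝ)) K) with hμ
  rw [Finset.sum_product_right, ← Finset.add_sum_erase _ _ hxB]
  refine add_le_add ?_ ?_
  · rw [Finset.sum_eq_single_of_mem x.1 hxA]
    · refine (measureReal_mono (Set.subset_univ _)).trans ?_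
      rw [hμ, measureReal_restrict_apply_univ, Real.volume_real_Icc_of_le (by
        have : (0 : ℝ) ≤ K := by positivity
        linarith)]
      linarith
    · intro a _ hne
      have : collisionSet x (a, x.2) = ∅ := by
        refine Set.eq_empty_of_forall_notMem fun l hl => hne ?_
        have hl' : x.1 + ⌊l * (x.2 : ℝ)⌋ = a + ⌊l * (x.2 : ℝ)⌋ := hl
        omega
      rw [this, measureReal_empty]
  · have hterm : ∀ b ∈ B.erase x.2, ∑ a ∈ A, μ.real (collisionSet x (a, b)) ≤
        CE * (2 * K + 3) ^ s * 2 * (L : ℝ) ^ max 0 (s + t - 1) *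
          ((b - x.2).natAbs : ℝ) ^ (-t) := by
      intro b hb
      obtain ⟨hne, hbB⟩ := Finset.mem_erase.1 hb
      set r : ℕ := (b - x.2).natAbs with hr
      have hr1 : 1 ≤ r := Int.natAbs_pos.2 (sub_ne_zero.2 hne)
      have hr1' : (1 : ℝ) ≤ r := by exact_mod_cast hr1
      have hrL : (r : ℝ) ≤ L := by exact_mod_cast hBL _ hxB _ hbB
      set T := A.filter (fun a => (a - x.1).natAbs ≤ (K + 1) * r) with hT
      have hcard : (T.card : ℝ) ≤ CE * ((2 * K + 3) * r) ^ s := by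
        have h1 : T.card ≤ icount E (x.1 - (K + 1) * r - 1) (x.1 + (K + 1) * r) := by
          refine card_le_icount fun a ha => ?_
          obtain ⟨haA, har⟩ := Finset.mem_filter.1 ha
          have har' : ((a - x.1).natAbs : ℤ) ≤ (K + 1) * r := by exact_mod_cast har
          exact ⟨hA a haA, by omega, by omega⟩
        have h0 : (0 : ℤ) ≤ (K + 1) * r := by positivity
        have h2 := hE (x.1 - (K + 1) * r - 1) (x.1 + (K + 1) * r) (by omega)
        refine (Nat.cast_le.2 h1).trans (h2.trans ?_)
        refine mul_le_mul_of_nonneg_left (Real.rpow_le_rpow ?_ ?_ hs) hCE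
        · exact_mod_cast (by omega :
            0 ≤ x.1 + (K + 1) * (r : ℤ) - (x.1 - (K + 1) * r - 1))
        · push_cast
          nlinarith
      calc ∑ a ∈ A, μ.real (collisionSet x (a, b))
          = ∑ a ∈ T, μ.real (collisionSet x (a, b)) := by
            symm
            refine Finset.sum_subset (Finset.filter_subset _ _) fun a ha haT => ?_
            rw [hμ, measureReal_restrict_apply (measurableSet_collisionSet _ _)]
            have : collisionSet x (a, b) ∩ Set.Icc (-(K : ℝ)) K = ∅ := by
              refine Set.eq_empty_of_forall_notMem fun l hl => haT ?_
              exact Finset.mem_filter.2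
                ⟨ha, natAbs_le_of_mem_collisionSet (y := (a, b)) hne hl.2 hl.1⟩
            rw [this, measureReal_empty]
        _ ≤ ∑ a ∈ T, 2 / (r : ℝ) :=
            Finset.sum_le_sum fun a _ => volume_real_collisionSet_le (y := (a, b)) hne K
        _ = T.card * (2 / (r : ℝ)) := by rw [Finset.sum_const, nsmul_eq_mul]
        _ ≤ CE * ((2 * K + 3) * r) ^ s * (2 / (r : ℝ)) := by gcongr
        _ = CE * (2 * K + 3) ^ s * 2 * (r : ℝ) ^ (s + t - 1) * (r : ℝ) ^ (-t) := by
            have h3 : (r : ℝ) ^ s * (1 / r) = (r : ℝ) ^ (s + t - 1) * (r : ℝ) ^ (-t) := by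
              rw [← Real.rpow_add (by linarith), one_div, ← Real.rpow_neg_one,
                ← Real.rpow_add (by linarith)]
              congr 1
              ring
            rw [Real.mul_rpow (by positivity) (by positivity)]
            linear_combination CE * (2 * K + 3) ^ s * 2 * h3
        _ ≤ _ := by
            gcongr
            calc (r : ℝ) ^ (s + t - 1) ≤ (r : ℝ) ^ max 0 (s + t - 1) :=
                  Real.rpow_le_rpow_of_exponent_le hr1' (le_max_right _ _)
              _ ≤ (L : ℝ) ^ max 0 (s + t - 1) :=
                  Real.rpow_le_rpow (by linarith) hrL (le_max_left _ _)
    refine (Finset.sum_le_sum hterm).trans ?_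
    rw [← Finset.mul_sum, ← Finset.filter_ne']
    exact mul_le_mul_of_nonneg_left
      (sum_natAbs_rpow_neg_le ht hF hB x.2 fun y hy => hBL _ hxB _ hy) (by positivity)

/-- Cauchy–Schwarz: a map with few collisions has a large image. -/
lemma sq_card_le_card_image_mul_collisions {α β : Type*} [DecidableEq β] (S : Finset α)
    (f : α → β) :
    (S.card : ℝ) ^ 2 ≤
      (S.image f).card * ∑ x ∈ S, ∑ y ∈ S, (if f x = f y then 1 else 0 : ℝ) := by
  have h1 : ∑ x ∈ S, ∑ y ∈ S, (if f x = f y then 1 else 0 : ℝ) =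
      ∑ z ∈ S.image f, ((S.filter (fun x => f x = z)).card : ℝ) ^ 2 := by
    rw [Finset.sum_comp (fun z => ∑ y ∈ S, (if z = f y then 1 else 0 : ℝ)) f]
    refine Finset.sum_congr rfl fun z _ => ?_
    rw [Finset.sum_boole, nsmul_eq_mul, sq]
    simp only [eq_comm]
  rw [h1, Finset.card_eq_sum_card_image f S]
  push_cast
  exact sq_sum_le_card_mul_sum_sq

lemma measureReal_card_image_lt_le {S : Finset (ℤ × ℤ)} {μ : Measure ℝ} [IsFiniteMeasure μ]
    {Q τ : ℝ} (hQ : 0 ≤ Q) (hτ : 0 < τ)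
    (h : ∀ x ∈ S, ∑ y ∈ S, μ.real (collisionSet x y) ≤ Q) :
    μ.real {l | τ * (S.image (fun x : ℤ × ℤ => x.1 + ⌊l * (x.2 : ℝ)⌋)).card < S.card} ≤
      Q / τ := by
  rcases S.eq_empty_or_nonempty with rfl | hne
  · simpa using div_nonneg hQ hτ.le
  have hc : (0 : ℝ) < S.card := by exact_mod_cast hne.card_pos
  set f : ℝ → ℝ := fun l => ∑ x ∈ S, ∑ y ∈ S, (collisionSet x y).indicator 1 l with hf
  have hind : ∀ x y, Integrable ((collisionSet x y).indicator (1 : ℝ → ℝ)) μ := fun x y =>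
    (integrable_const (1 : ℝ)).indicator (measurableSet_collisionSet x y)
  have hint : ∫ l, f l ∂μ ≤ S.card * Q := by
    rw [integral_finsetSum _ fun x _ => integrable_finsetSum _ fun y _ => hind x y,
      ← nsmul_eq_mul]
    refine Finset.sum_le_card_nsmul _ _ _ fun x hx => ?_
    rw [integral_finsetSum _ fun y _ => hind x y]
    simpa only [integral_indicator_one (measurableSet_collisionSet _ _)] using h x hx
  have hmarkov := mul_meas_ge_le_integral_of_nonneg (μ := μ) (f := f)
    (Filter.Eventually.of_forall fun l => Finset.sum_nonneg fun x _ => Finset.sum_nonneg fun y _ =>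
      Set.indicator_nonneg (fun _ _ => zero_le_one) l)
    (integrable_finsetSum _ fun x _ => integrable_finsetSum _ fun y _ => hind x y) (τ * S.card)
  have hsub : {l | τ * (S.image (fun x : ℤ × ℤ => x.1 + ⌊l * (x.2 : ℝ)⌋)).card < S.card} ⊆
      {l | τ * S.card ≤ f l} := by
    intro l hl
    by_contra hlt
    have hlt' : f l < τ * S.card := not_le.1 hlt
    have hl' : τ * (S.image (fun x : ℤ × ℤ => x.1 + ⌊l * (x.2 : ℝ)⌋)).card < S.card := hl
    have hcs : (S.card : ℝ) ^ 2 ≤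
        (S.image (fun x : ℤ × ℤ => x.1 + ⌊l * (x.2 : ℝ)⌋)).card * f l := by
      convert sq_card_le_card_image_mul_collisions S (fun x : ℤ × ℤ => x.1 + ⌊l * (x.2 : ℝ)⌋)
        using 2
      refine Finset.sum_congr rfl fun x _ => Finset.sum_congr rfl fun y _ => ?_
      simp [Set.indicator_apply, collisionSet]
    have h1 := mul_le_mul_of_nonneg_left hlt'.le
      (Nat.cast_nonneg (α := ℝ) (S.image (fun x : ℤ × ℤ => x.1 + ⌊l * (x.2 : ℝ)⌋)).card)
    nlinarith [mul_lt_mul_of_pos_right hl' hc]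
  refine (measureReal_mono hsub).trans ?_
  rw [le_div_iff₀ hτ]
  nlinarith

lemma ae_frequently_notMem_of_tendsto_zero {μ : Measure ℝ} [IsFiniteMeasure μ] {G : ℕ → Set ℝ}
    (h : Tendsto (fun n => μ.real (G n)) atTop (nhds 0)) :
    ∀ᵐ l ∂μ, ∃ᶠ n in atTop, l ∉ G n := by
  have h' : ∀ N, μ (⋂ n ≥ N, G n) = 0 := by
    intro N
    rw [← measureReal_eq_zero_iff]
    refine le_antisymm (ge_of_tendsto h ?_) measureReal_nonneg
    filter_upwards [eventually_ge_atTop N] with n hn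
    exact measureReal_mono (Set.biInter_subset_of_mem hn)
  filter_upwards [ae_all_iff.2 fun N => measure_eq_zero_iff_ae_notMem.1 (h' N)] with l hl hev
  obtain ⟨N, hN⟩ := eventually_atTop.1 hev
  exact hl N (Set.mem_iInter₂.2 fun n hn => not_not.1 (hN n hn))

lemma tendsto_natLog_mul_rpow_neg {ε : ℝ} (hε : 0 < ε) :
    Tendsto (fun n : ℕ => ((Nat.log 2 n : ℝ) + 1) * (n : ℝ) ^ (-ε)) atTop (nhds 0) := by
  have h1 : Tendsto (fun x : ℝ => (Real.log x / Real.log 2 + 1) * x ^ (-ε)) atTop (nhds 0) := by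
    have h2 := ((isLittleO_log_rpow_atTop hε).tendsto_div_nhds_zero.mul_const (Real.log 2)⁻¹).add
      (tendsto_rpow_neg_atTop hε)
    rw [zero_mul, zero_add] at h2
    refine h2.congr' ?_
    filter_upwards [eventually_gt_atTop 0] with x hx
    rw [Real.rpow_neg hx.le]
    ring
  refine squeeze_zero (fun n => by positivity) (fun n => ?_) (h1.comp tendsto_natCast_atTop_atTop)
  have := Real.natLog_le_logb n 2
  rw [Real.logb] at this
  push_cast at this
  exact mul_le_mul_of_nonneg_right (by linarith) (by positivity)

lemma eventually_rpow_le_mul_rpow {κ D m ε : ℝ} (hκ : 0 < κ) (hD : 1 ≤ D) (hε : 0 < ε) :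
    ∀ᶠ x : ℕ in atTop, ∀ y : ℝ, x ≤ y → y ≤ D * x → y ^ (m - 2 * ε) ≤ κ * (x : ℝ) ^ (m - ε) := by
  have h1 := ((tendsto_rpow_atTop hε).comp tendsto_natCast_atTop_atTop).eventually_ge_atTop
    (D ^ |m - 2 * ε| / κ)
  filter_upwards [h1, eventually_ge_atTop 1] with x hx hx1 y hxy hyx
  have hx1' : (1 : ℝ) ≤ x := by exact_mod_cast hx1
  have hx' : D ^ |m - 2 * ε| ≤ (x : ℝ) ^ ε * κ := (div_le_iff₀ hκ).1 hx
  have hy : y ^ (m - 2 * ε) ≤ D ^ |m - 2 * ε| * (x : ℝ) ^ (m - 2 * ε) := by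
    rcases le_total 0 (m - 2 * ε) with h0 | h0
    · rw [abs_of_nonneg h0, ← Real.mul_rpow (by linarith) (by linarith)]
      exact Real.rpow_le_rpow (by linarith) hyx h0
    · calc y ^ (m - 2 * ε) ≤ (x : ℝ) ^ (m - 2 * ε) :=
            Real.rpow_le_rpow_of_nonpos (by linarith) hxy h0
        _ ≤ _ := le_mul_of_one_le_left (by positivity) (Real.one_le_rpow hD (abs_nonneg _))
  calc y ^ (m - 2 * ε) ≤ D ^ |m - 2 * ε| * (x : ℝ) ^ (m - 2 * ε) := hy
    _ ≤ (x : ℝ) ^ ε * κ * (x : ℝ) ^ (m - 2 * ε) := by gcongr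
    _ = κ * (x : ℝ) ^ (m - ε) := by
      rw [show m - ε = ε + (m - 2 * ε) by ring, Real.rpow_add (by linarith)]
      ring

lemma image_subset_sumFloor {E F : Set ℤ} {A B : Finset ℤ} {K L : ℕ} {a b c d : ℤ} {l : ℝ}
    (hA : ∀ x ∈ A, x ∈ E ∧ a < x ∧ x ≤ b) (hB : ∀ y ∈ B, y ∈ F ∧ c < y ∧ y ≤ d)
    (hL : (L : ℤ) = d - c) (hl : l ∈ Set.Icc (-(K : ℝ)) K) :
    ∀ z ∈ (A ×ˢ B).image (fun x : ℤ × ℤ => x.1 + ⌊l * (x.2 : ℝ)⌋),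
      z ∈ sumFloor E F l ∧ a + ⌊l * (c : ℝ)⌋ - (K * L + 2) < z ∧
        z ≤ b + ⌊l * (c : ℝ)⌋ + (K * L + 2) := by
  intro z hz
  obtain ⟨⟨x, y⟩, hxy, rfl⟩ := Finset.mem_image.1 hz
  obtain ⟨hx, hy⟩ := Finset.mem_product.1 hxy
  obtain ⟨hxE, hax, hxb⟩ := hA x hx
  obtain ⟨hyF, hcy, hyd⟩ := hB y hy
  have h0 : (0 : ℝ) ≤ (y : ℝ) - c := sub_nonneg.2 (by exact_mod_cast hcy.le)
  have h1 : (y : ℝ) - c ≤ L := by exact_mod_cast (by omega : y - c ≤ L)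
  have hK0 : (0 : ℝ) ≤ K := by positivity
  have h2 : l * y ≤ l * c + K * L := by
    nlinarith [mul_le_mul_of_nonneg_right hl.2 h0, mul_le_mul_of_nonneg_left h1 hK0]
  have h3 : l * c - K * L ≤ l * y := by
    nlinarith [mul_le_mul_of_nonneg_right hl.1 h0, mul_le_mul_of_nonneg_left h1 hK0]
  have h4 : ⌊l * (y : ℝ)⌋ ≤ ⌊l * (c : ℝ)⌋ + K * L := by
    have := Int.floor_mono (h2.trans_eq (by push_cast; ring :
      l * (c : ℝ) + K * L = l * (c : ℝ) + ((K * L : ℤ) : ℝ)))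
    rwa [Int.floor_add_intCast] at this
  have h5 : ⌊l * (c : ℝ)⌋ - K * L ≤ ⌊l * (y : ℝ)⌋ := by
    have := Int.floor_mono (le_of_eq_of_le (by push_cast; ring :
      l * (c : ℝ) - ((K * L : ℤ) : ℝ) = l * (c : ℝ) - K * L) h3)
    rwa [Int.floor_sub_intCast] at this
  exact ⟨⟨x, hxE, y, hyF, rfl⟩, by dsimp only; linarith, by dsimp only; linarith⟩

lemma Compatible.ae_restrict_le_countingDim {E F : Set ℤ} (hE : Regular E) (hF : Regular F)
    (hEF : Compatible E F) {K : ℕ} (hK : 1 ≤ K) {ε : ℝ} (hε : 0 < ε) :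
    ∀ᵐ l ∂volume.restrict (Set.Icc (-(K : ℝ)) K),
      min 1 (countingDim E + countingDim F) - 2 * ε ≤ countingDim (sumFloor E F l) := by
  set s := countingDim E with hs_def
  set t := countingDim F with ht_def
  have hs : 0 ≤ s := countingDim_nonneg E
  have ht : 0 ≤ t := countingDim_nonneg F
  obtain ⟨CE, hCE, hE'⟩ := exists_icount_le hs hE.2
  obtain ⟨CF, hCF, hF'⟩ := exists_icount_le ht hF.2
  obtain ⟨a, b, c, d, hab, hcd, -, hmono, ⟨C, hC, hlen⟩, ⟨c₁, hc₁, hcE⟩, ⟨c₂, hc₂, hcF⟩⟩ := hEF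
  rw [← hs_def] at hcE
  rw [← ht_def] at hcF
  obtain ⟨ℓ, hℓ⟩ : ∃ ℓ : ℕ → ℕ, ∀ n, (ℓ n : ℤ) = d n - c n :=
    ⟨fun n => (d n - c n).toNat, fun n => Int.toNat_of_nonneg (by linarith [hcd n])⟩
  have hℓmono : StrictMono ℓ := fun i j hij => by
    have := hmono hij
    simp only [← hℓ] at this
    exact_mod_cast this
  have hℓtop : Tendsto ℓ atTop atTop := hℓmono.tendsto_atTop
  have hℓ1 : ∀ n, (1 : ℝ) ≤ ℓ n := fun n => by
    have h1 := hcd n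
    have h2 := hℓ n
    exact_mod_cast (by omega : 1 ≤ ℓ n)
  have hℓR : ∀ n, ((d n - c n : ℤ) : ℝ) = ℓ n := fun n => by rw [← hℓ n, Int.cast_natCast]
  set A : ℕ → Finset ℤ := fun n => (Set.Ioc_inter_finite E (a n) (b n)).toFinset with hA_def
  set B : ℕ → Finset ℤ := fun n => (Set.Ioc_inter_finite F (c n) (d n)).toFinset with hB_def
  have hA : ∀ n, ∀ x ∈ A n, x ∈ E ∧ a n < x ∧ x ≤ b n := fun n x hx => by
    simpa [hA_def] using hx
  have hB : ∀ n, ∀ x ∈ B n, x ∈ F ∧ c n < x ∧ x ≤ d n := fun n x hx => by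
    simpa [hB_def] using hx
  have hAcard : ∀ n, (A n).card = icount E (a n) (b n) := fun n =>
    (Set.ncard_eq_toFinset_card _ _).symm
  have hBcard : ∀ n, (B n).card = icount F (c n) (d n) := fun n =>
    (Set.ncard_eq_toFinset_card _ _).symm
  set m₀ := max 0 (s + t - 1) with hm₀
  have hm : min 1 (s + t) = s + t - m₀ := by
    rw [hm₀]
    rcases le_total (s + t) 1 with h | h
    · rw [min_eq_right h, max_eq_left (by linarith), sub_zero]
    · rw [min_eq_left h, max_eq_right (by linarith)]
      ring
  set P : ℝ := CE * (2 * K + 3) ^ s * 2 with hP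
  have hP0 : 0 ≤ P := by positivity
  set Q : ℕ → ℝ := fun n =>
    2 * K + P * (ℓ n : ℝ) ^ m₀ * (CF * 4 ^ t * (Nat.log 2 (ℓ n) + 1)) with hQ
  set τ : ℕ → ℝ := fun n => (ℓ n : ℝ) ^ (m₀ + ε) with hτ
  have hτ0 : ∀ n, 0 < τ n := fun n => Real.rpow_pos_of_pos (by linarith [hℓ1 n]) _
  set G : ℕ → Set ℝ := fun n =>
    {l | τ n * ((A n ×ˢ B n).image (fun x : ℤ × ℤ => x.1 + ⌊l * (x.2 : ℝ)⌋)).card <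
      (A n ×ˢ B n).card} with hG
  have hbad : ∀ n, (volume.restrict (Set.Icc (-(K : ℝ)) K)).real (G n) ≤ Q n / τ n := fun n => by
    refine measureReal_card_image_lt_le (by positivity) (hτ0 n) fun x hx => ?_
    refine sum_volume_real_collisionSet_le hs ht hCE.le hE' hF' (fun x hx => (hA n x hx).1)
      (fun x hx => (hB n x hx).1) (fun x hx y hy => ?_) K hx
    have h1 := hB n x hx
    have h2 := hB n y hy
    have h3 := hℓ n
    omega
  have hQτ : ∀ n, Q n / τ n ≤
      (2 * K + P * (CF * 4 ^ t)) * (((Nat.log 2 (ℓ n) : ℝ) + 1) * (ℓ n : ℝ) ^ (-ε)) := fun n => by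
    have hpos : (0 : ℝ) < ℓ n := by linarith [hℓ1 n]
    have hpow : (1 : ℝ) ≤ (ℓ n : ℝ) ^ m₀ := Real.one_le_rpow (hℓ1 n) (le_max_left _ _)
    have hlog : (1 : ℝ) ≤ (Nat.log 2 (ℓ n) : ℝ) + 1 := by
      have : (0 : ℝ) ≤ (Nat.log 2 (ℓ n) : ℝ) := by positivity
      linarith
    have h1 : 2 * (K : ℝ) ≤ 2 * K * ((ℓ n : ℝ) ^ m₀ * ((Nat.log 2 (ℓ n) : ℝ) + 1)) :=
      le_mul_of_one_le_right (by positivity) (one_le_mul_of_one_le_of_one_le hpow hlog)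
    rw [div_le_iff₀ (hτ0 n)]
    have h2 : (ℓ n : ℝ) ^ (-ε) * τ n = (ℓ n : ℝ) ^ m₀ := by
      rw [hτ, ← Real.rpow_add hpos]
      congr 1
      ring
    calc Q n ≤ (2 * K + P * (CF * 4 ^ t)) *
          (((Nat.log 2 (ℓ n) : ℝ) + 1) * (ℓ n : ℝ) ^ m₀) := by
          rw [hQ]
          linarith
      _ = _ := by
          rw [← h2]
          ring
  have hlim : Tendsto (fun n => (volume.restrict (Set.Icc (-(K : ℝ)) K)).real (G n)) atTop
      (nhds 0) := by
    refine squeeze_zero (fun _ => measureReal_nonneg) (fun n => (hbad n).trans (hQτ n)) ?_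
    simpa using ((tendsto_natLog_mul_rpow_neg hε).comp hℓtop).const_mul
      (2 * K + P * (CF * 4 ^ t))
  set κ : ℝ := c₁ * (1 / C) ^ s * c₂ with hκ
  have hκ0 : 0 < κ := by positivity
  have hcard : ∀ n, κ * (ℓ n : ℝ) ^ (s + t) ≤ (A n ×ˢ B n).card := fun n => by
    have hpos : (0 : ℝ) < ℓ n := by linarith [hℓ1 n]
    have h1 : (ℓ n : ℝ) / C ≤ ((b n - a n : ℤ) : ℝ) := by
      rw [div_le_iff₀' hC, ← hℓR]
      exact (hlen n).2
    have h2 : c₁ * ((ℓ n : ℝ) / C) ^ s ≤ (A n).card := by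
      rw [hAcard]
      refine le_trans ?_ (hcE n)
      gcongr
    have h3 : c₂ * (ℓ n : ℝ) ^ t ≤ (B n).card := by
      rw [hBcard, ← hℓR]
      exact hcF n
    calc κ * (ℓ n : ℝ) ^ (s + t) = (c₁ * ((ℓ n : ℝ) / C) ^ s) * (c₂ * (ℓ n : ℝ) ^ t) := by
          rw [hκ, Real.rpow_add hpos, div_eq_mul_one_div (ℓ n : ℝ),
            Real.mul_rpow hpos.le (by positivity)]
          ring
      _ ≤ (A n).card * (B n).card := by gcongr
      _ = _ := by rw [Finset.card_product, Nat.cast_mul]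
  have hlarge := hℓtop.eventually (eventually_rpow_le_mul_rpow (κ := κ) (D := C + 2 * K + 4)
    (m := min 1 (s + t)) (ε := ε) hκ0 (by
      have : (0 : ℝ) ≤ K := by positivity
      linarith) hε)
  filter_upwards [ae_frequently_notMem_of_tendsto_zero hlim,
    ae_restrict_mem measurableSet_Icc] with l hl hlK
  refine le_countingDim_of_long_intervals fun L₀ => ?_
  obtain ⟨n, hnG, hn, hnL⟩ :=
    (hl.and_eventually (hlarge.and (hℓtop.eventually_ge_atTop L₀.toNat))).exists
  have hpos : (0 : ℝ) < ℓ n := by linarith [hℓ1 n]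
  have hKL : (ℓ n : ℤ) ≤ K * ℓ n := by exact_mod_cast Nat.le_mul_of_pos_left _ hK
  have habn := hab n
  refine ⟨a n + ⌊l * (c n : ℝ)⌋ - (K * ℓ n + 2), b n + ⌊l * (c n : ℝ)⌋ + (K * ℓ n + 2),
    by omega, ?_⟩
  have hcount := card_le_icount (image_subset_sumFloor (hA n) (hB n) (hℓ n) hlK)
  refine le_trans (hn _ ?_ ?_) (le_trans ?_ (Nat.cast_le.2 hcount))
  · exact_mod_cast (by omega : (ℓ n : ℤ) ≤ b n + ⌊l * (c n : ℝ)⌋ + (K * ℓ n + 2) -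
      (a n + ⌊l * (c n : ℝ)⌋ - (K * ℓ n + 2)))
  · have h1 := (hlen n).1
    rw [hℓR] at h1
    push_cast at h1 ⊢
    linarith [hℓ1 n]
  · have h1 : ((A n ×ˢ B n).card : ℝ) ≤
        τ n * ((A n ×ˢ B n).image (fun x : ℤ × ℤ => x.1 + ⌊l * (x.2 : ℝ)⌋)).card :=
      not_lt.1 hnG
    have h2 := (hcard n).trans h1
    refine le_of_mul_le_mul_left (le_of_eq_of_le ?_ h2) (hτ0 n)
    rw [hτ, hm, mul_left_comm, ← Real.rpow_add hpos]
    congr 2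
    ring

/-- **Marstrand theorem for subsets of integers** (Theorem 1.1, dimension part).
If `E, F ⊆ ℤ` are regular compatible sets, then for Lebesgue almost every `λ ∈ ℝ`,
`D(E + ⌊λ F⌋) ≥ min {1, D(E) + D(F)}`. -/
theorem marstrand_dimension (E F : Set ℤ) (hE : Regular E) (hF : Regular F)
    (hEF : Compatible E F) :
    ∀ᵐ l : ℝ ∂(volume : Measure ℝ),
      min 1 (countingDim E + countingDim F) ≤ countingDim (sumFloor E F l) := by
  have h : ∀ᵐ l : ℝ ∂(volume : Measure ℝ), ∀ K j : ℕ,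
      l ∈ Set.Icc (-((K + 1 : ℕ) : ℝ)) ((K + 1 : ℕ) : ℝ) →
      min 1 (countingDim E + countingDim F) - 2 * (1 / ((j : ℝ) + 1)) ≤
        countingDim (sumFloor E F l) :=
    ae_all_iff.2 fun K => ae_all_iff.2 fun j => (ae_restrict_iff' measurableSet_Icc).1 <|
      hEF.ae_restrict_le_countingDim hE hF (Nat.le_add_left 1 K) (by positivity)
  filter_upwards [h] with l hl
  obtain ⟨K, hK⟩ := exists_nat_ge |l|
  have hlK : l ∈ Set.Icc (-((K + 1 : ℕ) : ℝ)) ((K + 1 : ℕ) : ℝ) := by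
    refine abs_le.1 (hK.trans ?_)
    push_cast
    linarith
  have hlim := (tendsto_one_div_add_atTop_nhds_zero_nat (𝕜 := ℝ)).const_mul 2 |>.const_sub
    (min 1 (countingDim E + countingDim F))
  rw [mul_zero, sub_zero] at hlim
  exact le_of_tendsto' hlim fun j => hl K j hlK
end
end

section
/- For i = 0, 1, …, k let p_i ∈ ℤ[x] be a polynomial of degree d_i ≥ 1 and let E_i = {p_i(n) : n ∈ ℤ}. Then for Lebesgue almost every (λ_1,…,λ_k) ∈ ℝ^k, D(E_0 + ⌊λ_1E_1⌋ + … + ⌊λ_kE_k⌋) ≥ min{1, 1/d_0 + 1/d_1 + … + 1/d_k}, where the sum set consists of all a_0 + ⌊λ_1a_1⌋ + … + ⌊λ_ka_k⌋ with a_i ∈ E_i. -/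
open Filter MeasureTheory
open scoped ENNReal

noncomputable section

theorem volume_box_inter_strip_le {k : ℕ} {R b c : ℝ} (hR : 0 ≤ R) (u : Fin (k + 1) → ℝ)
    (j : Fin (k + 1)) (hj : u j ≠ 0) :
    volume {l : Fin (k + 1) → ℝ | (∀ i, |l i| ≤ R) ∧ |c + ∑ i, l i * u i| ≤ b} ≤
      ENNReal.ofReal ((2 * R) ^ k * (2 * b / |u j|)) := by
  set S := {l : Fin (k + 1) → ℝ | (∀ i, |l i| ≤ R) ∧ |c + ∑ i, l i * u i| ≤ b} with hS
  have hmp := (volume_preserving_piFinSuccAbove (fun _ : Fin (k + 1) => ℝ) j).symm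
  have hSm : MeasurableSet S := by
    have : S = (⋂ i, {l : Fin (k + 1) → ℝ | |l i| ≤ R}) ∩ {l | |c + ∑ i, l i * u i| ≤ b} := by
      ext; simp [hS]
    rw [this]
    exact (MeasurableSet.iInter fun i => measurableSet_le (by fun_prop) (by fun_prop)).inter
      (measurableSet_le (by fun_prop) (by fun_prop))
  rw [← hmp.measure_preimage hSm.nullMeasurableSet, Measure.volume_eq_prod,
    Measure.prod_apply_symm (hmp.measurable hSm)]
  have hpt : ∀ y : Fin k → ℝ, volume ((fun x : ℝ => (x, y)) ⁻¹'
      ((MeasurableEquiv.piFinSuccAbove (fun _ : Fin (k + 1) => ℝ) j).symm ⁻¹' S)) ≤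
      (Set.univ.pi fun _ => Set.Icc (-R) R).indicator
        (fun _ => ENNReal.ofReal (2 * b / |u j|)) y := by
    intro y
    by_cases hy : y ∈ Set.univ.pi fun _ : Fin k => Set.Icc (-R) R
    · rw [Set.indicator_of_mem hy]
      set e := c + ∑ i, y i * u (j.succAbove i)
      refine (measure_mono (t := Metric.closedBall (-e / u j) (b / |u j|)) ?_).trans_eq ?_
      · rintro x ⟨-, hx⟩
        rw [Fin.sum_univ_succAbove _ j] at hx
        simp only [MeasurableEquiv.piFinSuccAbove_symm_apply, Fin.insertNthEquiv_apply,
          Fin.insertNth_apply_same, Fin.insertNth_apply_succAbove] at hx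
        rw [Metric.mem_closedBall, Real.dist_eq, le_div_iff₀ (abs_pos.2 hj), ← abs_mul]
        have he : (x - -e / u j) * u j =
            c + (x * u j + ∑ i, y i * u (j.succAbove i)) := by
          simp only [e]; field_simp; ring
        rwa [he]
      · rw [Real.volume_closedBall, mul_div_assoc]
    · rw [Set.indicator_of_notMem hy, nonpos_iff_eq_zero]
      convert measure_empty (μ := (volume : Measure ℝ))
      rw [Set.eq_empty_iff_forall_notMem]
      rintro x ⟨hx, -⟩
      refine hy fun i _ => abs_le.1 ?_
      simpa using hx (j.succAbove i)
  refine (lintegral_mono hpt).trans ?_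
  rw [lintegral_indicator (MeasurableSet.univ_pi fun _ => measurableSet_Icc), setLIntegral_const,
    volume_pi, Measure.pi_pi]
  simp only [Real.volume_Icc, Finset.prod_const, Finset.card_univ, Fintype.card_fin]
  rw [mul_comm, ENNReal.ofReal_mul (by positivity), ENNReal.ofReal_pow (by positivity)]
  gcongr
  linarith

theorem ae_frequently_lt_one {Ω : Type*} [MeasurableSpace Ω] {μ : Measure Ω} {g : ℕ → Ω → ℝ≥0∞}
    (hg : ∀ n, Measurable (g n)) (h : Tendsto (fun n => ∫⁻ x, g n x ∂μ) atTop (nhds 0)) :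
    ∀ᵐ x ∂μ, ∃ᶠ n in atTop, g n x < 1 := by
  have h0 : ∫⁻ x, liminf (fun n => g n x) atTop ∂μ = 0 :=
    le_antisymm ((lintegral_liminf_le hg).trans_eq h.liminf_eq) bot_le
  rw [lintegral_eq_zero_iff (Measurable.liminf hg)] at h0
  filter_upwards [h0] with x hx
  refine frequently_lt_of_liminf_lt (by isBoundedDefault) ?_
  rw [hx]; simp

theorem sq_card_le_card_image_mul_card_collisions {α β : Type*} [DecidableEq β] (s : Finset α)
    (f : α → β) :
    s.card ^ 2 ≤ (s.image f).card * ((s ×ˢ s).filter fun x => f x.1 = f x.2).card := by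
  have h1 := Finset.card_eq_sum_card_image f s
  have h2 : ((s ×ˢ s).filter fun x => f x.1 = f x.2).card =
      ∑ b ∈ s.image f, (s.filter fun a => f a = b).card ^ 2 := by
    rw [Finset.card_eq_sum_card_fiberwise (f := fun x => f x.1) (t := s.image f)]
    · refine Finset.sum_congr rfl fun b _ => ?_
      rw [sq, ← Finset.card_product]
      congr 1
      ext ⟨x, y⟩
      simp only [Finset.mem_filter, Finset.mem_product]
      grind
    · intro x hx
      simp only [Finset.coe_filter, Finset.mem_product, Set.mem_ofPred_eq] at hx
      exact Finset.mem_coe.2 (Finset.mem_image_of_mem _ hx.1.1)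
  rw [h2, h1]
  exact sq_sum_le_card_mul_sum_sq

theorem exists_separation (p : Polynomial ℤ) (hp : 1 ≤ p.natDegree) :
    ∃ C : ℝ, 0 < C ∧ ∃ M₀ : ℕ, ∀ M : ℕ, M₀ ≤ M →
      (∀ m ∈ Finset.Ico M (2 * M), |((p.eval (m : ℤ) : ℤ) : ℝ)| ≤ C * (M : ℝ) ^ p.natDegree) ∧
      ∀ m n : ℕ, M ≤ m → M ≤ n → |(m : ℝ) - n| * (M : ℝ) ^ (p.natDegree - 1) / 2 ≤
        |((p.eval (m : ℤ) : ℤ) : ℝ) - (p.eval (n : ℤ) : ℤ)| := by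
  set d := p.natDegree with hd
  set q : Polynomial ℝ := p.map (Int.castRingHom ℝ) with hq
  have hqd : q.natDegree = d := Polynomial.natDegree_map_eq_of_injective Int.cast_injective p
  have hev : ∀ m : ℕ, ((p.eval (m : ℤ) : ℤ) : ℝ) = q.eval (m : ℝ) := by
    intro m
    simp [hq]
  obtain ⟨C, hC, hbd⟩ := (Polynomial.isEquivalent_atTop_lead q).isBigO.exists_pos
  have hlead : 1 ≤ |q.leadingCoeff| := by
    rw [hq, Polynomial.leadingCoeff_map_of_injective Int.cast_injective]
    have : p.leadingCoeff ≠ 0 := by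
      rw [Ne, Polynomial.leadingCoeff_eq_zero]; rintro rfl; simp [hd] at hp
    rw [eq_intCast]
    exact_mod_cast Int.one_le_abs this
  have hder : ∀ᶠ x : ℝ in atTop, x ^ (d - 1) / 2 ≤ |q.derivative.eval x| := by
    have h2 := (Polynomial.isEquivalent_atTop_lead q.derivative).isLittleO.bound
      (show (0 : ℝ) < 1 / 2 by norm_num)
    filter_upwards [h2, eventually_ge_atTop 0] with x hx hx0
    simp only [Pi.sub_apply, Polynomial.natDegree_derivative, Polynomial.leadingCoeff_derivative, hqd,
      norm_mul, norm_pow, Real.norm_eq_abs, abs_of_nonneg hx0] at hx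
    have hl : 1 ≤ |q.leadingCoeff * d| := by
      rw [abs_mul, Nat.abs_cast]
      have : (1 : ℝ) ≤ d := by exact_mod_cast hp
      nlinarith
    have h3 := abs_sub_abs_le_abs_sub (q.leadingCoeff * d * x ^ (d - 1)) (q.derivative.eval x)
    rw [abs_sub_comm, abs_mul, abs_pow, abs_of_nonneg hx0] at h3
    have h4 : 0 ≤ x ^ (d - 1) := by positivity
    rw [← abs_mul] at hx
    nlinarith
  rw [Asymptotics.IsBigOWith] at hbd
  obtain ⟨X, hX⟩ := eventually_atTop.1 (hbd.and hder)
  refine ⟨C * (|q.leadingCoeff| * 2 ^ d), by positivity, ⌈X⌉₊, fun M hM => ⟨?_, ?_⟩⟩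
  · intro m hm
    rw [Finset.mem_Ico] at hm
    have := (hX m ((Nat.le_ceil X).trans (by exact_mod_cast hM.trans hm.1))).1
    rw [hev, ← Real.norm_eq_abs]
    refine this.trans ?_
    rw [norm_mul, hqd, Real.norm_eq_abs, norm_pow, Real.norm_natCast, mul_assoc, mul_assoc,
      ← mul_pow]
    gcongr
    exact_mod_cast hm.2.le
  · intro m n hm hn
    wlog hmn : m < n generalizing m n
    · rcases (not_lt.1 hmn).eq_or_lt with rfl | h
      · simp
      · rw [abs_sub_comm, abs_sub_comm ((p.eval (m : ℤ) : ℤ) : ℝ)]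
        exact this n m hn hm h
    obtain ⟨x, hx, hxe⟩ := exists_hasDerivAt_eq_slope (fun x => q.eval x)
      (fun x => q.derivative.eval x) (show (m : ℝ) < n by exact_mod_cast hmn)
      q.continuous.continuousOn (fun x _ => q.hasDerivAt x)
    have hMx : (M : ℝ) ≤ x := (Nat.cast_le.2 hm).trans hx.1.le
    have h2 := (hX x ((Nat.le_ceil X).trans ((Nat.cast_le.2 hM).trans hMx))).2
    have hnm : (0 : ℝ) < n - m := sub_pos.2 (by exact_mod_cast hmn)
    rw [hxe, abs_div, abs_of_pos hnm, le_div_iff₀ hnm, ← hev, ← hev] at h2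
    rw [abs_sub_comm, abs_of_pos hnm, abs_sub_comm ((p.eval (m : ℤ) : ℤ) : ℝ)]
    refine le_trans ?_ h2
    have : (M : ℝ) ^ (d - 1) ≤ x ^ (d - 1) := by gcongr
    nlinarith

theorem sum_rpow_neg_separation_le {x : ℕ → ℝ} {M d : ℕ} {θ : ℝ} (hM : 1 ≤ M) (hd : 1 ≤ d)
    (hθ : 0 ≤ θ) (hdθ : d * θ ≤ 1)
    (hsep : ∀ m n : ℕ, M ≤ m → M ≤ n →
      |(m : ℝ) - n| * (M : ℝ) ^ (d - 1) / 2 ≤ |x m - x n|)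
    {m : ℕ} (hm : m ∈ Finset.Ico M (2 * M)) :
    ∑ n ∈ Finset.Ico M (2 * M), (max 1 |x m - x n|) ^ (-θ) ≤
      8 * ((M : ℝ) ^ (1 - d * θ) * (1 + Real.log M)) := by
  rw [Finset.mem_Ico] at hm
  have hM0 : (1 : ℝ) ≤ M := by exact_mod_cast hM
  have hMp : (0 : ℝ) < M := by linarith
  set B : ℝ := 4 * (M : ℝ) ^ (1 - d * θ) with hB
  have hB1 : 4 ≤ B := by
    have := Real.one_le_rpow hM0 (show 0 ≤ 1 - d * θ by linarith)
    linarith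
  have hθ1 : θ ≤ 1 := by
    have : (1 : ℝ) ≤ d := by exact_mod_cast hd
    nlinarith
  have hterm : ∀ n ∈ Finset.Ico M (2 * M),
      (max 1 |x m - x n|) ^ (-θ) ≤ B * ((Nat.dist m n : ℝ) + 1)⁻¹ := by
    intro n hn
    rw [Finset.mem_Ico] at hn
    rcases eq_or_ne m n with rfl | hmn
    · simp [Nat.dist_self]; linarith
    have hdist : |(m : ℝ) - n| = Nat.dist m n := by
      have : |(m : ℤ) - n| = Nat.dist m n := by
        rw [abs_eq_max_neg]; unfold Nat.dist; omega
      exact_mod_cast this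
    set j := Nat.dist m n with hj
    have hj1 : 1 ≤ j := Nat.dist_pos_of_ne hmn
    have hjM : j ≤ M := by rw [hj]; unfold Nat.dist; omega
    have hj1' : (1 : ℝ) ≤ j := by exact_mod_cast hj1
    have hjM' : (j : ℝ) ≤ M := by exact_mod_cast hjM
    have hjp : (0 : ℝ) < j := by linarith
    have hlow := hsep m n hm.1 hn.1
    rw [hdist] at hlow
    have hpow : (j : ℝ) * (M : ℝ) ^ (d - 1) / 2 = (j / M : ℝ) * (M : ℝ) ^ d * 2⁻¹ := by
      obtain ⟨e, rfl⟩ := Nat.exists_eq_add_of_le' hd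
      simp only [Nat.add_sub_cancel, pow_succ]
      field_simp
    rw [hpow] at hlow
    calc (max 1 |x m - x n|) ^ (-θ) ≤ ((j / M : ℝ) * (M : ℝ) ^ d * 2⁻¹) ^ (-θ) :=
          Real.rpow_le_rpow_of_nonpos (by positivity) (hlow.trans (le_max_right _ _)) (by linarith)
      _ = (j / M : ℝ) ^ (-θ) * (M : ℝ) ^ (-(d * θ)) * 2 ^ θ := by
          rw [Real.mul_rpow (by positivity) (by positivity),
            Real.mul_rpow (by positivity) (by positivity), ← Real.rpow_natCast,
            ← Real.rpow_mul hMp.le, Real.inv_rpow (by norm_num),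
            Real.rpow_neg (x := 2) (by norm_num), inv_inv, mul_neg]
      _ ≤ (j / M : ℝ) ^ (-1 : ℝ) * (M : ℝ) ^ (-(d * θ)) * 2 ^ (1 : ℝ) := by
          have h1 : (j / M : ℝ) ^ (-θ) ≤ (j / M : ℝ) ^ (-1 : ℝ) :=
            Real.rpow_le_rpow_of_exponent_ge (by positivity) ((div_le_one hMp).2 hjM')
              (by linarith)
          have h2 : (2 : ℝ) ^ θ ≤ 2 ^ (1 : ℝ) :=
            Real.rpow_le_rpow_of_exponent_le (by norm_num) hθ1
          gcongr
      _ = B / 2 * (j : ℝ)⁻¹ := by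
          rw [hB, Real.rpow_one, Real.rpow_neg_one, sub_eq_add_neg, Real.rpow_add hMp,
            Real.rpow_one]
          field_simp
          norm_num
      _ ≤ B * ((j : ℝ) + 1)⁻¹ := by
          have : (j : ℝ)⁻¹ ≤ ((j : ℝ) + 1)⁻¹ * 2 := by
            rw [inv_mul_eq_div, le_div_iff₀ (by positivity), inv_mul_le_iff₀ hjp]; linarith
          nlinarith
  have hH : ∑ j ∈ Finset.range M, ((j : ℝ) + 1)⁻¹ ≤ 1 + Real.log M := by
    have := harmonic_le_one_add_log M
    simpa [harmonic] using this
  have hhalf : ∀ s ⊆ Finset.Ico M (2 * M), Set.InjOn (Nat.dist m) s →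
      ∑ n ∈ s, ((Nat.dist m n : ℝ) + 1)⁻¹ ≤ 1 + Real.log M := by
    intro s hs hinj
    rw [← Finset.sum_image (f := fun j : ℕ => ((j : ℝ) + 1)⁻¹) hinj]
    refine (Finset.sum_le_sum_of_subset_of_nonneg ?_ fun _ _ _ => by positivity).trans hH
    intro j hj
    obtain ⟨n, hn, rfl⟩ := Finset.mem_image.1 hj
    have := Finset.mem_Ico.1 (hs hn)
    rw [Finset.mem_range]; unfold Nat.dist; omega
  refine (Finset.sum_le_sum hterm).trans ?_
  rw [← Finset.mul_sum, ← Finset.sum_filter_add_sum_filter_not _ (fun n => n ≤ m)]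
  have h1 := hhalf _ (Finset.filter_subset (fun n => n ≤ m) _) (by
    intro a ha b hb h
    simp only [Finset.coe_filter, Set.mem_ofPred_eq] at ha hb
    unfold Nat.dist at h; omega)
  have h2 := hhalf _ (Finset.filter_subset (fun n => ¬ n ≤ m) _) (by
    intro a ha b hb h
    simp only [Finset.coe_filter, Set.mem_ofPred_eq] at ha hb
    unfold Nat.dist at h; omega)
  calc _ ≤ B * ((1 + Real.log M) + (1 + Real.log M)) := by gcongr
    _ = _ := by rw [hB]; ring

theorem inv_le_prod_rpow_neg {ι : Type*} (s : Finset ι) {v θ : ι → ℝ} {X : ℝ} (hX : 1 ≤ X)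
    (hv : ∀ i, 1 ≤ v i) (hvX : ∀ i, v i ≤ X) (hθ : ∀ i, 0 ≤ θ i) (hsum : ∑ i ∈ s, θ i ≤ 1) :
    X⁻¹ ≤ ∏ i ∈ s, v i ^ (-θ i) := by
  calc X⁻¹ = X ^ (-1 : ℝ) := (Real.rpow_neg_one X).symm
    _ ≤ X ^ (∑ i ∈ s, -θ i) := by
        rw [Finset.sum_neg_distrib]
        exact Real.rpow_le_rpow_of_exponent_le hX (by linarith)
    _ = ∏ i ∈ s, X ^ (-θ i) := Real.rpow_sum_of_pos (by linarith) _ _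
    _ ≤ _ := Finset.prod_le_prod (fun i _ => by positivity) fun i _ =>
        Real.rpow_le_rpow_of_nonpos (by linarith [hv i]) (hvX i) (by linarith [hθ i])

/-- The value `a₀ + ∑ ⌊lᵢ aᵢ₊₁⌋`. -/
def floorForm {k : ℕ} (l : Fin k → ℝ) (a : Fin (k + 1) → ℤ) : ℤ :=
  a 0 + ∑ i : Fin k, ⌊l i * ((a i.succ : ℤ) : ℝ)⌋

theorem measurable_floorForm {k : ℕ} (a : Fin (k + 1) → ℤ) :
    Measurable fun l : Fin k → ℝ => floorForm l a := by
  unfold floorForm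
  fun_prop

theorem abs_sub_le_of_floorForm_eq {k : ℕ} {l : Fin k → ℝ} {a b : Fin (k + 1) → ℤ}
    (h : floorForm l a = floorForm l b) :
    |((a 0 : ℝ) - b 0) + ∑ i, l i * ((a i.succ : ℝ) - b i.succ)| ≤ k := by
  have h' : ((a 0 : ℝ) - b 0) + ∑ i, l i * ((a i.succ : ℝ) - b i.succ) =
      ∑ i, (Int.fract (l i * (a i.succ : ℝ)) - Int.fract (l i * (b i.succ : ℝ))) := by
    have hc : (floorForm l a : ℝ) = floorForm l b := by rw [h]
    simp only [floorForm, Int.cast_add, Int.cast_sum] at hc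
    simp only [Int.fract, mul_sub, Finset.sum_sub_distrib]
    linarith
  rw [h']
  calc _ ≤ ∑ i : Fin k, |Int.fract (l i * (a i.succ : ℝ)) - Int.fract (l i * (b i.succ : ℝ))| :=
        Finset.abs_sum_le_sum_abs _ _
    _ ≤ ∑ _i : Fin k, (1 : ℝ) := by
        refine Finset.sum_le_sum fun i _ => abs_le.2 ⟨?_, ?_⟩ <;>
        linarith [Int.fract_nonneg (l i * (a i.succ : ℝ)), Int.fract_lt_one (l i * (a i.succ : ℝ)),
          Int.fract_nonneg (l i * (b i.succ : ℝ)), Int.fract_lt_one (l i * (b i.succ : ℝ))]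
    _ = k := by simp

theorem volume_collision_le (k : ℕ) {R : ℝ} (hR : 0 ≤ R) :
    ∃ K : ℝ, 0 ≤ K ∧ ∀ (θ : Fin (k + 1) → ℝ), (∀ i, 0 ≤ θ i) → ∑ i, θ i ≤ 1 →
      ∀ a b : Fin (k + 1) → ℤ,
        volume {l : Fin k → ℝ | floorForm l a = floorForm l b ∧ ∀ i, |l i| ≤ R} ≤
          ENNReal.ofReal (K * ∏ i, (max 1 |(a i : ℝ) - b i|) ^ (-θ i)) := by
  set X₀ : ℝ := k * (1 + R) + 1 with hX₀
  have hX₀1 : 1 ≤ X₀ := by rw [hX₀]; linarith [show 0 ≤ k * (1 + R) by positivity]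
  refine ⟨(2 * R) ^ k + (2 * R) ^ (k - 1) * (2 * k) * X₀, by positivity, ?_⟩
  intro θ hθ hsum a b
  set S := {l : Fin k → ℝ | floorForm l a = floorForm l b ∧ ∀ i, |l i| ≤ R} with hS
  set P := ∏ i, (max 1 |(a i : ℝ) - b i|) ^ (-θ i) with hP
  have hP0 : 0 ≤ P := Finset.prod_nonneg fun i _ => by positivity
  rcases S.eq_empty_or_nonempty with hSe | ⟨l₀, hl₀, hl₀R⟩
  · simp [hSe]
  by_cases hab : ∀ i : Fin k, a i.succ = b i.succ
  · have h0 : a 0 = b 0 := by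
      simpa [floorForm, hab] using hl₀
    have hall : a = b := by
      ext i; induction i using Fin.cases with
      | zero => exact h0
      | succ i => exact hab i
    have hP1 : P = 1 := by simp [hP, hall]
    rw [hP1, mul_one]
    calc volume S ≤ volume (Metric.closedBall (0 : Fin k → ℝ) R) := by
          refine measure_mono fun l hl => ?_
          rw [mem_closedBall_zero_iff, pi_norm_le_iff_of_nonneg hR]
          exact hl.2
      _ = ENNReal.ofReal ((2 * R) ^ k) := by
          rw [Real.volume_pi_closedBall _ hR, Fintype.card_fin]
      _ ≤ _ := ENNReal.ofReal_le_ofReal (by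
          have : 0 ≤ (2 * R) ^ (k - 1) * (2 * k) * X₀ := by positivity
          linarith)
  · push Not at hab
    obtain ⟨i₀, hi₀⟩ := hab
    obtain ⟨n, rfl⟩ : ∃ n, k = n + 1 := ⟨k - 1, by have := i₀.pos; omega⟩
    obtain ⟨j, -, hj⟩ := Finset.exists_max_image Finset.univ
      (fun i : Fin (n + 1) => |(a i.succ : ℝ) - b i.succ|) ⟨i₀, Finset.mem_univ _⟩
    set w := |(a j.succ : ℝ) - b j.succ| with hw
    have hw1 : 1 ≤ w := by
      refine le_trans ?_ (hj i₀ (Finset.mem_univ _))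
      exact_mod_cast Int.one_le_abs (sub_ne_zero.2 hi₀)
    have hwp : 0 < w := by linarith
    have hX : ∀ i, max 1 |(a i : ℝ) - b i| ≤ X₀ * w := by
      intro i
      refine max_le (by nlinarith) ?_
      induction i using Fin.cases with
      | succ i => exact (hj i (Finset.mem_univ _)).trans (by nlinarith)
      | zero =>
        have h1 := abs_sub_le_of_floorForm_eq hl₀
        have h2 : |∑ i, l₀ i * ((a i.succ : ℝ) - b i.succ)| ≤ (n + 1 : ℕ) * (R * w) := by
          calc _ ≤ ∑ i, |l₀ i * ((a i.succ : ℝ) - b i.succ)| := Finset.abs_sum_le_sum_abs _ _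
            _ ≤ ∑ _i : Fin (n + 1), R * w := Finset.sum_le_sum fun i hi => by
                rw [abs_mul]
                exact mul_le_mul (hl₀R i) (hj i hi) (abs_nonneg _) hR
            _ = _ := by simp
        have h3 := abs_sub_abs_le_abs_add ((a 0 : ℝ) - b 0)
          (∑ i, l₀ i * ((a i.succ : ℝ) - b i.succ))
        have h4 : ((n + 1 : ℕ) : ℝ) ≤ (n + 1 : ℕ) * w := le_mul_of_one_le_right (by positivity) hw1
        rw [hX₀]
        nlinarith
    have hPX := inv_le_prod_rpow_neg Finset.univ (by nlinarith : 1 ≤ X₀ * w)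
      (fun i => le_max_left _ _) hX hθ hsum
    rw [← hP] at hPX
    calc volume S ≤ volume {l : Fin (n + 1) → ℝ | (∀ i, |l i| ≤ R) ∧
            |((a 0 : ℝ) - b 0) + ∑ i, l i * ((a i.succ : ℝ) - b i.succ)| ≤ (n + 1 : ℕ)} :=
          measure_mono fun l hl => ⟨hl.2, abs_sub_le_of_floorForm_eq hl.1⟩
      _ ≤ ENNReal.ofReal ((2 * R) ^ n * (2 * (n + 1 : ℕ) / w)) :=
          volume_box_inter_strip_le hR _ j (abs_pos.1 hwp)
      _ ≤ _ := by
          refine ENNReal.ofReal_le_ofReal ?_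
          rw [add_mul, Nat.add_sub_cancel]
          have h5 : (2 * R) ^ n * (2 * (n + 1 : ℕ) / w) =
              (2 * R) ^ n * (2 * (n + 1 : ℕ)) * X₀ * (X₀ * w)⁻¹ := by
            field_simp
          rw [h5]
          have h6 : 0 ≤ (2 * R) ^ (n + 1) * P := by positivity
          have h7 : (2 * R) ^ n * (2 * (n + 1 : ℕ)) * X₀ * (X₀ * w)⁻¹ ≤
              (2 * R) ^ n * (2 * (n + 1 : ℕ)) * X₀ * P := by gcongr
          linarith

theorem le_countingDim_of_frequently {S : Set ℤ} {C D : ℕ} (hC : 1 ≤ C) (hD : 1 ≤ D) {s : ℝ}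
    (h : ∀ δ : ℝ, 0 < δ → ∃ᶠ T : ℕ in atTop,
      (T : ℝ) ^ (D * s - δ) ≤ icount S (-(C * T ^ D : ℕ)) (C * T ^ D : ℕ)) :
    s ≤ countingDim S := by
  have hD0 : (0 : ℝ) < D := by exact_mod_cast hD
  refine le_of_forall_lt_imp_le_of_dense fun c hc => ?_
  have hbdd : IsBoundedUnder (· ≤ ·) intervalFilter fun p : ℤ × ℤ =>
      Real.log (icount S p.1 p.2) / Real.log ((p.2 - p.1 : ℤ) : ℝ) := by
    refine ⟨1, eventually_map.2 ?_⟩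
    filter_upwards [tendsto_comap.eventually (eventually_ge_atTop (2 : ℤ))] with p hp
    have hlen : (2 : ℝ) ≤ ((p.2 - p.1 : ℤ) : ℝ) := by exact_mod_cast hp
    rw [div_le_one (Real.log_pos (by linarith))]
    have hle : icount S p.1 p.2 ≤ (p.2 - p.1).toNat := by
      rw [← Int.card_Ioc, ← Set.ncard_coe_finset, Finset.coe_Ioc]
      exact Set.ncard_le_ncard Set.inter_subset_right (Set.finite_Ioc _ _)
    have hle' : (icount S p.1 p.2 : ℝ) ≤ ((p.2 - p.1 : ℤ) : ℝ) := by
      have : (icount S p.1 p.2 : ℤ) ≤ p.2 - p.1 := by omega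
      exact_mod_cast this
    rcases Nat.eq_zero_or_pos (icount S p.1 p.2) with h0 | h0
    · rw [h0, Nat.cast_zero, Real.log_zero]; exact Real.log_nonneg (by linarith)
    · exact Real.log_le_log (by exact_mod_cast h0) hle'
  refine le_limsup_of_frequently_le ?_ hbdd
  have hN : Tendsto (fun T : ℕ => T ^ D) atTop atTop := tendsto_pow_atTop (by omega)
  have hinterval : Tendsto (fun T : ℕ => ((-(C * T ^ D : ℕ) : ℤ), ((C * T ^ D : ℕ) : ℤ))) atTop
      intervalFilter := by
    refine tendsto_comap_iff.2 ?_
    refine tendsto_atTop_mono (f := fun T : ℕ => ((T ^ D : ℕ) : ℤ)) ?_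
      (tendsto_natCast_atTop_atTop.comp hN)
    intro T
    have : T ^ D ≤ C * T ^ D := Nat.le_mul_of_pos_left _ hC
    simp only [Function.comp]
    omega
  set δ := D * (s - c) / 2 with hδ
  have hδ0 : 0 < δ := by have := sub_pos.2 hc; positivity
  have hlog : ∀ᶠ T : ℕ in atTop, c * Real.log (2 * C) ≤ δ * Real.log T :=
    ((Real.tendsto_log_atTop.comp tendsto_natCast_atTop_atTop).const_mul_atTop
      hδ0).eventually_ge_atTop _
  refine hinterval.frequently (((h δ hδ0).and_eventually (hlog.and (eventually_ge_atTop 1))).mono ?_)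
  rintro T ⟨h1, h2, h3⟩
  have hT : (1 : ℝ) ≤ T := by exact_mod_cast h3
  have hC' : (1 : ℝ) ≤ C := by exact_mod_cast hC
  have hTD : (1 : ℝ) ≤ (T : ℝ) ^ D := one_le_pow₀ hT
  have hlen : (((C * T ^ D : ℕ) : ℤ) - -((C * T ^ D : ℕ) : ℤ) : ℤ) = (2 * C * T ^ D : ℝ) := by
    push_cast; ring
  simp only [hlen]
  rw [le_div_iff₀ (Real.log_pos (by nlinarith))]
  refine le_trans ?_ (Real.log_le_log (by positivity) h1)
  rw [Real.log_mul (by positivity) (by positivity), Real.log_pow, Real.log_rpow (by linarith)]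
  have hexp : D * s - δ = δ + c * D := by rw [hδ]; ring
  rw [hexp]
  linarith

theorem lintegral_card_collisions_le (k : ℕ) {R : ℝ} (hR : 0 ≤ R) :
    ∃ K : ℝ, 0 ≤ K ∧ ∀ (x : Fin (k + 1) → ℕ → ℤ) (M d : Fin (k + 1) → ℕ) (θ : Fin (k + 1) → ℝ),
      (∀ i, 1 ≤ M i) → (∀ i, 1 ≤ d i) → (∀ i, 0 ≤ θ i) → ∑ i, θ i ≤ 1 →
      (∀ i, d i * θ i ≤ 1) →
      (∀ i, ∀ m n : ℕ, M i ≤ m → M i ≤ n →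
        |(m : ℝ) - n| * (M i : ℝ) ^ (d i - 1) / 2 ≤ |(x i m : ℝ) - x i n|) →
      ∫⁻ l in {l : Fin k → ℝ | ∀ i, |l i| ≤ R},
        ((((Fintype.piFinset fun i => Finset.Ico (M i) (2 * M i)) ×ˢ
          (Fintype.piFinset fun i => Finset.Ico (M i) (2 * M i))).filter fun y =>
            floorForm l (fun i => x i (y.1 i)) = floorForm l (fun i => x i (y.2 i))).card : ℝ≥0∞) ≤
      ENNReal.ofReal (K * ∏ i, ((M i : ℝ) *
        (8 * ((M i : ℝ) ^ (1 - d i * θ i) * (1 + Real.log (M i)))))) := by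
  obtain ⟨K, hK, hvol⟩ := volume_collision_le k hR
  refine ⟨K, hK, fun x M d θ hM hd hθ hsum hdθ hsep => ?_⟩
  set A := Fintype.piFinset fun i => Finset.Ico (M i) (2 * M i) with hA
  have hmeas : ∀ y : (Fin (k + 1) → ℕ) × (Fin (k + 1) → ℕ), MeasurableSet
      {l : Fin k → ℝ | floorForm l (fun i => x i (y.1 i)) = floorForm l (fun i => x i (y.2 i))} :=
    fun y => measurableSet_eq_fun (measurable_floorForm _) (measurable_floorForm _)
  set F : (Fin (k + 1) → ℕ) → (Fin (k + 1) → ℕ) → ℝ := fun m n =>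
    ∏ i, (max 1 |(x i (m i) : ℝ) - x i (n i)|) ^ (-θ i) with hF
  have hF0 : ∀ m n, 0 ≤ F m n := fun m n => Finset.prod_nonneg fun i _ => by positivity
  have hcard : ∀ l : Fin k → ℝ, (((A ×ˢ A).filter fun y =>
      floorForm l (fun i => x i (y.1 i)) = floorForm l (fun i => x i (y.2 i))).card : ℝ≥0∞) =
      ∑ y ∈ A ×ˢ A, {l : Fin k → ℝ | floorForm l (fun i => x i (y.1 i)) =
        floorForm l (fun i => x i (y.2 i))}.indicator 1 l := by
    intro l
    simp [Set.indicator_apply]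
  simp_rw [hcard]
  rw [lintegral_finsetSum _ fun y _ => measurable_one.indicator (hmeas y)]
  calc _ ≤ ∑ y ∈ A ×ˢ A, ENNReal.ofReal (K * F y.1 y.2) := by
        refine Finset.sum_le_sum fun y _ => ?_
        rw [lintegral_indicator_one (hmeas y), Measure.restrict_apply (hmeas y)]
        exact hvol θ hθ hsum _ _
    _ = ENNReal.ofReal (∑ y ∈ A ×ˢ A, K * F y.1 y.2) :=
        (ENNReal.ofReal_sum_of_nonneg fun y _ => mul_nonneg hK (hF0 _ _)).symm
    _ ≤ _ := by
        refine ENNReal.ofReal_le_ofReal ?_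
        rw [← Finset.mul_sum, Finset.sum_product, Finset.prod_mul_distrib]
        refine mul_le_mul_of_nonneg_left ?_ hK
        calc ∑ m ∈ A, ∑ n ∈ A, F m n ≤ ∑ m ∈ A, ∏ i,
              (8 * ((M i : ℝ) ^ (1 - d i * θ i) * (1 + Real.log (M i)))) := by
              refine Finset.sum_le_sum fun m hm => ?_
              rw [hA, Fintype.mem_piFinset] at hm
              simp only [hF, hA]
              rw [← Finset.prod_univ_sum (fun i => Finset.Ico (M i) (2 * M i))
                fun i n => (max 1 |(x i (m i) : ℝ) - x i n|) ^ (-θ i)]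
              exact Finset.prod_le_prod
                (fun i _ => Finset.sum_nonneg fun n _ => by positivity) fun i _ =>
                sum_rpow_neg_separation_le (x := fun n => (x i n : ℝ)) (hM i) (hd i) (hθ i) (hdθ i)
                  (hsep i) (hm i)
          _ = _ := by
              rw [Finset.sum_const, nsmul_eq_mul, hA, Fintype.card_piFinset]
              congr 1
              push_cast [Nat.card_Ico]
              exact Finset.prod_congr rfl fun i _ => by
                rw [show 2 * M i - M i = M i by omega]

theorem tendsto_prod_rpow_neg_mul_log {ι : Type*} [Fintype ι] [Nonempty ι] (e : ι → ℕ) {δ : ℝ}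
    (hδ : 0 < δ) :
    Tendsto (fun T : ℕ => ∏ i, ((T : ℝ) ^ (-δ) * (1 + Real.log ((T ^ e i : ℕ) : ℝ)))) atTop
      (nhds 0) := by
  have h1 : Tendsto (fun T : ℝ => T ^ (-δ)) atTop (nhds 0) := tendsto_rpow_neg_atTop hδ
  have h2 : Tendsto (fun T : ℝ => Real.log T / T ^ δ) atTop (nhds 0) :=
    (isLittleO_log_rpow_atTop hδ).tendsto_div_nhds_zero
  have h3 : ∀ i, Tendsto (fun T : ℝ => T ^ (-δ) * (1 + e i * Real.log T)) atTop (nhds 0) := by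
    intro i
    have := h1.add (h2.const_mul (e i : ℝ))
    rw [mul_zero, add_zero] at this
    refine this.congr' ?_
    filter_upwards [eventually_ge_atTop 0] with T hT
    rw [Real.rpow_neg hT]; ring
  have h4 := tendsto_finsetProd Finset.univ fun i _ => (h3 i).comp tendsto_natCast_atTop_atTop
  simpa using h4

theorem ae_frequently_rpow_le_card_image {k : ℕ} {R δ : ℝ} (hR : 0 ≤ R) (hδ : 0 < δ)
    (x : Fin (k + 1) → ℕ → ℤ) (d e : Fin (k + 1) → ℕ) (θ : Fin (k + 1) → ℝ) {D : ℕ}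
    (hd : ∀ i, 1 ≤ d i) (hde : ∀ i, e i * d i = D)
    (hθ : ∀ i, 0 ≤ θ i) (hsum : ∑ i, θ i ≤ 1) (hdθ : ∀ i, d i * θ i ≤ 1)
    (hsep : ∀ᶠ T : ℕ in atTop, ∀ i, ∀ m n : ℕ, T ^ e i ≤ m → T ^ e i ≤ n →
      |(m : ℝ) - n| * ((T ^ e i : ℕ) : ℝ) ^ (d i - 1) / 2 ≤ |(x i m : ℝ) - x i n|) :
    ∀ᵐ l : Fin k → ℝ, (∀ i, |l i| ≤ R) → ∃ᶠ T : ℕ in atTop,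
      (T : ℝ) ^ (D * ∑ i, θ i - (k + 1) * δ) ≤
        (((Fintype.piFinset fun i => Finset.Ico (T ^ e i) (2 * T ^ e i)).image fun m =>
          floorForm l fun i => x i (m i)).card : ℝ) := by
  obtain ⟨K, hK, hlint⟩ := lintegral_card_collisions_le k hR
  set A : ℕ → Finset (Fin (k + 1) → ℕ) := fun T =>
    Fintype.piFinset fun i => Finset.Ico (T ^ e i) (2 * T ^ e i) with hA
  set N : ℕ → (Fin k → ℝ) → ℕ := fun T l => ((A T ×ˢ A T).filter fun y =>
    floorForm l (fun i => x i (y.1 i)) = floorForm l (fun i => x i (y.2 i))).card with hN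
  set s := D * ∑ i, θ i - (k + 1) * δ with hs
  have hcardA : ∀ T, ((A T).card : ℝ) = ∏ i, ((T ^ e i : ℕ) : ℝ) := by
    intro T
    simp only [hA, Fintype.card_piFinset, Nat.card_Ico]
    push_cast
    refine Finset.prod_congr rfl fun i _ => ?_
    rw [show 2 * T ^ e i - T ^ e i = T ^ e i by omega]; push_cast; rfl
  set c : ℕ → ℝ := fun T => (T : ℝ) ^ s / ((A T).card : ℝ) ^ 2 with hc
  have hc0 : ∀ T, 0 ≤ c T := fun T => by positivity
  have hbox : MeasurableSet {l : Fin k → ℝ | ∀ i, |l i| ≤ R} := by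
    have : {l : Fin k → ℝ | ∀ i, |l i| ≤ R} = ⋂ i, {l | |l i| ≤ R} := by ext; simp
    rw [this]
    exact MeasurableSet.iInter fun i => measurableSet_le (by fun_prop) (by fun_prop)
  have hNm : ∀ T, Measurable fun l => (N T l : ℝ≥0∞) := by
    intro T
    have : (fun l => (N T l : ℝ≥0∞)) = fun l => ∑ y ∈ A T ×ˢ A T,
        {l : Fin k → ℝ | floorForm l (fun i => x i (y.1 i)) =
          floorForm l (fun i => x i (y.2 i))}.indicator 1 l := by
      ext l; simp [hN, Set.indicator_apply]
    rw [this]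
    exact Finset.measurable_sum _ fun y _ => measurable_one.indicator
      (measurableSet_eq_fun (measurable_floorForm _) (measurable_floorForm _))
  have hlim : Tendsto (fun T => ∫⁻ l in {l : Fin k → ℝ | ∀ i, |l i| ≤ R},
      ENNReal.ofReal (c T) * N T l) atTop (nhds 0) := by
    have hz := (tendsto_prod_rpow_neg_mul_log e hδ).const_mul (K * 8 ^ (k + 1))
    rw [mul_zero] at hz
    have hz' := ENNReal.tendsto_ofReal hz
    rw [ENNReal.ofReal_zero] at hz'
    refine tendsto_of_tendsto_of_tendsto_of_le_of_le' tendsto_const_nhds hz'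
      (Eventually.of_forall fun _ => zero_le) ?_
    filter_upwards [hsep, eventually_ge_atTop 1] with T hT hT1
    have hTp : (0 : ℝ) < T := by exact_mod_cast hT1
    rw [lintegral_const_mul _ (hNm T)]
    refine (mul_le_mul_right (hlint x (fun i => T ^ e i) d θ
      (fun i => Nat.one_le_pow _ _ hT1) hd hθ hsum hdθ hT) _).trans_eq ?_
    rw [← ENNReal.ofReal_mul (hc0 T)]
    congr 1
    have hpow : ∀ i, ((T ^ e i : ℕ) : ℝ) ^ (1 - d i * θ i) =
        ((T ^ e i : ℕ) : ℝ) * (T : ℝ) ^ (-(D * θ i)) := by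
      intro i
      rw [sub_eq_add_neg, Real.rpow_add (by positivity), Real.rpow_one]
      congr 1
      rw [Nat.cast_pow, ← Real.rpow_natCast, ← Real.rpow_mul hTp.le, ← hde i]
      congr 1
      push_cast; ring
    have hTs : (T : ℝ) ^ s = ∏ i, ((T : ℝ) ^ (D * θ i) * (T : ℝ) ^ (-δ)) := by
      simp_rw [← Real.rpow_add hTp]
      rw [← Real.rpow_sum_of_pos hTp, Finset.sum_add_distrib, hs, Finset.mul_sum]
      simp; ring_nf
    have h8 : (8 : ℝ) ^ (k + 1) = ∏ _i : Fin (k + 1), (8 : ℝ) := by simp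
    rw [hc]
    simp only
    rw [hcardA, hTs, h8, mul_assoc K, ← Finset.prod_mul_distrib, mul_left_comm, ← Finset.prod_pow,
      ← Finset.prod_div_distrib, ← Finset.prod_mul_distrib]
    congr 1
    refine Finset.prod_congr rfl fun i _ => ?_
    rw [hpow, Real.rpow_neg hTp.le (D * θ i)]
    have : (0 : ℝ) < ((T ^ e i : ℕ) : ℝ) := by positivity
    field_simp
  have hae := ae_frequently_lt_one (fun T => (hNm T).const_mul (ENNReal.ofReal (c T))) hlim
  rw [ae_restrict_iff' hbox] at hae
  filter_upwards [hae] with l hl hlR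
  refine ((hl hlR).and_eventually (eventually_ge_atTop 1)).mono ?_
  rintro T ⟨hT, hT1⟩
  have hTp : (0 : ℝ) < T := by exact_mod_cast hT1
  rw [← ENNReal.ofReal_natCast, ← ENNReal.ofReal_mul (hc0 T), ENNReal.ofReal_lt_one] at hT
  have hcs := sq_card_le_card_image_mul_card_collisions (A T)
    fun m => floorForm l fun i => x i (m i)
  have hcs' : ((A T).card : ℝ) ^ 2 ≤
      (((A T).image fun m => floorForm l fun i => x i (m i)).card : ℝ) * (N T l : ℝ) := by
    exact_mod_cast hcs
  have hQ : 0 < ((A T).card : ℝ) := by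
    rw [hcardA]; exact Finset.prod_pos fun i _ => by positivity
  rw [hc] at hT
  simp only at hT
  rw [div_mul_eq_mul_div, div_lt_one (by positivity)] at hT
  have hNp : (0 : ℝ) < N T l := by
    rcases (Nat.cast_nonneg (α := ℝ) (N T l)).eq_or_lt with h | h
    · rw [← h, mul_zero] at hcs'
      exact absurd hcs' (not_le.2 (by positivity))
    · exact h
  exact le_of_mul_le_mul_right (hT.le.trans hcs') hNp

theorem exists_abs_floorForm_le (k : ℕ) {R C : ℝ} (hR : 0 ≤ R) :
    ∃ B : ℕ, 1 ≤ B ∧ ∀ (l : Fin k → ℝ) (a : Fin (k + 1) → ℤ) (N : ℕ), (∀ i, |l i| ≤ R) → 1 ≤ N →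
      (∀ i, |(a i : ℝ)| ≤ C * N) → |floorForm l a| < (B * N : ℕ) := by
  refine ⟨⌈C + k * (R * C + 1)⌉₊ + 1, by omega, fun l a N hl hN ha => ?_⟩
  have hN' : (1 : ℝ) ≤ N := by exact_mod_cast hN
  have h1 : |(floorForm l a : ℝ)| ≤ C * N + k * (R * (C * N) + 1) := by
    unfold floorForm
    push_cast
    refine (abs_add_le _ _).trans (add_le_add (ha 0) ?_)
    calc _ ≤ ∑ i : Fin k, |(⌊l i * (a i.succ : ℝ)⌋ : ℝ)| := Finset.abs_sum_le_sum_abs _ _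
      _ ≤ ∑ _i : Fin k, (R * (C * N) + 1) := by
          refine Finset.sum_le_sum fun i _ => ?_
          have h2 : |l i * (a i.succ : ℝ)| ≤ R * (C * N) := by
            rw [abs_mul]; exact mul_le_mul (hl i) (ha _) (abs_nonneg _) hR
          rw [abs_le] at h2 ⊢
          constructor <;>
          linarith [Int.floor_le (l i * (a i.succ : ℝ)), Int.lt_floor_add_one (l i * (a i.succ : ℝ))]
      _ = _ := by rw [Finset.sum_const, nsmul_eq_mul, Finset.card_univ, Fintype.card_fin]
  have h3 := Nat.le_ceil (C + k * (R * C + 1))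
  have h4 : |(floorForm l a : ℝ)| < ((⌈C + k * (R * C + 1)⌉₊ + 1 : ℕ) : ℝ) * N := by
    have h5 : (k : ℝ) ≤ k * N := le_mul_of_one_le_right (by positivity) hN'
    have h6 := mul_le_mul_of_nonneg_right h3 (by linarith : (0 : ℝ) ≤ N)
    push_cast
    linarith
  have h7 : ((|floorForm l a| : ℤ) : ℝ) < (((⌈C + k * (R * C + 1)⌉₊ + 1) * N : ℕ) : ℝ) := by
    push_cast at h4 ⊢; exact h4
  exact_mod_cast h7

theorem exists_weights {ι : Type*} [Fintype ι] [Nonempty ι] (d : ι → ℕ) (hd : ∀ i, 1 ≤ d i) :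
    ∃ θ : ι → ℝ, (∀ i, 0 ≤ θ i) ∧ ∑ i, θ i = min 1 (∑ i, (1 : ℝ) / d i) ∧
      ∀ i, d i * θ i ≤ 1 := by
  have hd0 : ∀ i, (0 : ℝ) < d i := fun i => by exact_mod_cast hd i
  have hα0 : 0 < ∑ i, (1 : ℝ) / d i :=
    Finset.sum_pos (fun i _ => one_div_pos.2 (hd0 i)) Finset.univ_nonempty
  generalize hα : ∑ i, (1 : ℝ) / d i = α at hα0
  have hr : 0 ≤ min 1 α / α := div_nonneg (le_min zero_le_one hα0.le) hα0.le
  refine ⟨fun i => 1 / d i * (min 1 α / α),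
    fun i => mul_nonneg (one_div_pos.2 (hd0 i)).le hr, ?_, fun i => ?_⟩
  · rw [← Finset.sum_mul, hα, mul_div_cancel₀ _ hα0.ne']
  · rw [← mul_assoc, mul_one_div_cancel (hd0 i).ne', one_mul, div_le_one hα0]
    exact min_le_right _ _

/-- **Theorem 1.2, dimension part.** For polynomials `p_0, …, p_k ∈ ℤ[x]` of degrees
`d_i ≥ 1` and `E_i = p_i(ℤ)`, for Lebesgue almost every `(λ_1, …, λ_k) ∈ ℝ^k`,
`D(E_0 + ⌊λ_1 E_1⌋ + ⋯ + ⌊λ_k E_k⌋) ≥ min {1, 1/d_0 + ⋯ + 1/d_k}`. -/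
theorem marstrand_polynomial_dimension (k : ℕ) (p : Fin (k + 1) → Polynomial ℤ)
    (hdeg : ∀ i, 1 ≤ (p i).natDegree) :
    ∀ᵐ l : Fin k → ℝ ∂(volume : Measure (Fin k → ℝ)),
      min 1 (∑ i : Fin (k + 1), (1 : ℝ) / ((p i).natDegree : ℝ)) ≤
        countingDim
          {n : ℤ | ∃ a : Fin (k + 1) → ℤ, (∀ i, a i ∈ Set.range fun m : ℤ => (p i).eval m) ∧
            n = a 0 + ∑ i : Fin k, ⌊l i * ((a i.succ : ℤ) : ℝ)⌋} := by
  choose C hC M₀ hM₀ using fun i => exists_separation (p i) (hdeg i)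
  set d : Fin (k + 1) → ℕ := fun i => (p i).natDegree with hd
  set D := ∏ i, d i with hD
  have hdvd : ∀ i, d i ∣ D := fun i => Finset.dvd_prod_of_mem d (Finset.mem_univ i)
  set e : Fin (k + 1) → ℕ := fun i => D / d i with he
  have hde : ∀ i, e i * d i = D := fun i => Nat.div_mul_cancel (hdvd i)
  have hD1 : 1 ≤ D := Finset.one_le_prod' fun i _ => hdeg i
  have he1 : ∀ i, e i ≠ 0 := fun i h => by
    have := hde i; rw [h] at this; omega
  obtain ⟨θ, hθ0, hθs, hdθ⟩ := exists_weights d hdeg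
  have hlarge : ∀ᶠ T : ℕ in atTop, ∀ i, M₀ i ≤ T ^ e i :=
    eventually_all.2 fun i => (tendsto_pow_atTop (he1 i)).eventually_ge_atTop _
  have hsep := hlarge.mono fun T hT i => (hM₀ i _ (hT i)).2
  have hmain : ∀ᵐ l : Fin k → ℝ, ∀ R n : ℕ, (∀ i, |l i| ≤ R) → ∃ᶠ T : ℕ in atTop,
      (T : ℝ) ^ (D * ∑ i, θ i - (k + 1) * (1 / (n + 1 : ℝ))) ≤
        (((Fintype.piFinset fun i => Finset.Ico (T ^ e i) (2 * T ^ e i)).image fun m =>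
          floorForm l fun i => (p i).eval (m i : ℤ)).card : ℝ) :=
    ae_all_iff.2 fun R => ae_all_iff.2 fun n =>
      ae_frequently_rpow_le_card_image (Nat.cast_nonneg R) (by positivity)
        (fun i m => (p i).eval (m : ℤ)) d e θ hdeg hde hθ0
        (hθs.le.trans (min_le_left _ _)) hdθ hsep
  filter_upwards [hmain] with l hl
  obtain ⟨R, hR⟩ : ∃ R : ℕ, ∀ i, |l i| ≤ R :=
    ⟨⌈‖l‖⌉₊, fun i => (norm_le_pi_norm l i).trans (Nat.le_ceil _)⟩
  obtain ⟨B, hB1, hB⟩ := exists_abs_floorForm_le k (Nat.cast_nonneg R)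
    (C := ∑ i, C i)
  refine le_countingDim_of_frequently hB1 hD1 fun δ hδ => ?_
  obtain ⟨n, hn⟩ := exists_nat_one_div_lt (show 0 < δ / (k + 1) by positivity)
  refine ((hl R n hR).and_eventually (hlarge.and (eventually_ge_atTop 1))).mono ?_
  rintro T ⟨hT, hTM, hT1⟩
  have hT1' : (1 : ℝ) ≤ T := by exact_mod_cast hT1
  refine (Real.rpow_le_rpow_of_exponent_le hT1' ?_).trans (hT.trans ?_)
  · rw [hθs]
    rw [lt_div_iff₀ (by positivity)] at hn
    linarith
  · rw [Nat.cast_le, icount, ← Set.ncard_coe_finset]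
    refine Set.ncard_le_ncard ?_ ((Set.finite_Ioc _ _).subset Set.inter_subset_right)
    intro y hy
    obtain ⟨m, hm, rfl⟩ := Finset.mem_image.1 (Finset.mem_coe.1 hy)
    rw [Fintype.mem_piFinset] at hm
    refine ⟨⟨fun i => (p i).eval (m i : ℤ), fun i => ⟨m i, rfl⟩, rfl⟩, ?_⟩
    have hb := hB l (fun i => (p i).eval (m i : ℤ)) (T ^ D) hR (Nat.one_le_pow _ _ hT1) fun i => by
      refine ((hM₀ i _ (hTM i)).1 _ (hm i)).trans ?_
      have h1 : ((T ^ e i : ℕ) : ℝ) ^ (p i).natDegree = ((T ^ D : ℕ) : ℝ) := by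
        rw [← hde i, pow_mul]; push_cast; rfl
      rw [h1]
      gcongr
      exact Finset.single_le_sum (f := C) (fun j _ => (hC j).le) (Finset.mem_univ i)
    rw [abs_lt] at hb
    exact ⟨hb.1, hb.2.le⟩
end
end

section
/- For i = 0, 1, …, k let p_i ∈ ℤ[x] be a polynomial of degree d_i ≥ 1 and let E_i = {p_i(n) : n ∈ ℤ}. If 1/d_0 + 1/d_1 + … + 1/d_k > 1, then for Lebesgue almost every (λ_1,…,λ_k) ∈ ℝ^k, the sum set E_0 + ⌊λ_1E_1⌋ + … + ⌊λ_kE_k⌋ = {a_0 + ⌊λ_1a_1⌋ + … + ⌊λ_ka_k⌋ : a_i ∈ E_i} has positive upper-Banach density. -/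
open Filter MeasureTheory
open scoped ENNReal

noncomputable section

theorem Polynomial.eventually_pos_of_leadingCoeff_pos (P : Polynomial ℝ)
    (h : 0 < P.leadingCoeff) : ∀ᶠ x in atTop, 0 < P.eval x := by
  rcases Nat.eq_zero_or_pos P.natDegree with h0 | h0
  · rw [Polynomial.eq_C_of_natDegree_eq_zero h0] at h ⊢
    exact Eventually.of_forall fun x => by simpa using h
  · exact (P.tendsto_atTop_of_leadingCoeff_nonneg
      (Polynomial.natDegree_pos_iff_degree_pos.1 h0) h.le).eventually_gt_atTop 0

theorem Polynomial.eventually_pow_sub_le (P : Polynomial ℝ) (hd : 1 ≤ P.natDegree)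
    (h : 1 ≤ P.leadingCoeff) :
    ∃ x₀ : ℝ, ∀ x y, x₀ ≤ x → x ≤ y →
      (y - x) ^ P.natDegree ≤ 2 * (P.eval y - P.eval x) := by
  set d := P.natDegree with hdef
  set Q : Polynomial ℝ := Polynomial.C 2 * P - Polynomial.X ^ d with hQ
  have hQd : Q.natDegree ≤ d := by
    refine (Polynomial.natDegree_sub_le _ _).trans (max_le ?_ ?_)
    · exact (Polynomial.natDegree_C_mul_le _ _)
    · simp
  have hc : Q.coeff d = 2 * P.leadingCoeff - 1 := by
    simp [hQ, Polynomial.leadingCoeff, ← hdef]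
  have hc' : 0 < Q.derivative.coeff (d - 1) := by
    rw [Polynomial.coeff_derivative, Nat.sub_add_cancel hd, hc]
    have : (0 : ℝ) < 2 * P.leadingCoeff - 1 := by linarith
    positivity
  have hlead : 0 < Q.derivative.leadingCoeff := by
    have h1 : Q.derivative.natDegree ≤ d - 1 :=
      (Polynomial.natDegree_derivative_le _).trans (Nat.sub_le_sub_right hQd 1)
    have h2 : d - 1 ≤ Q.derivative.natDegree := Polynomial.le_natDegree_of_ne_zero hc'.ne'
    rwa [Polynomial.leadingCoeff, le_antisymm h1 h2]
  obtain ⟨x₁, hx₁⟩ := eventually_atTop.1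
    (Polynomial.eventually_pos_of_leadingCoeff_pos _ hlead)
  refine ⟨max x₁ 0, fun x y hx hxy => ?_⟩
  have hmono : MonotoneOn (fun z => Q.eval z) (Set.Ici (max x₁ 0)) := by
    refine monotoneOn_of_deriv_nonneg (convex_Ici _) Q.continuous.continuousOn
      Q.differentiable.differentiableOn fun z hz => ?_
    rw [interior_Ici] at hz
    rw [Polynomial.deriv]
    exact (hx₁ z ((le_max_left _ _).trans (le_of_lt hz))).le
  have h1 := hmono (Set.mem_Ici.2 hx) (Set.mem_Ici.2 (hx.trans hxy)) hxy
  have hx0 : 0 ≤ x := (le_max_right _ _).trans hx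
  have h2 : (y - x) ^ d + x ^ d ≤ (y - x + x) ^ d :=
    pow_add_pow_le (sub_nonneg.2 hxy) hx0 (by lia)
  rw [sub_add_cancel] at h2
  simp only [hQ, Polynomial.eval_sub, Polynomial.eval_mul, Polynomial.eval_C,
    Polynomial.eval_pow, Polynomial.eval_X] at h1
  linarith

theorem Polynomial.exists_nat_abs_sub_pow_le (p : Polynomial ℤ) (hd : 1 ≤ p.natDegree) :
    ∃ m₀ : ℕ, ∀ m m' : ℕ, |(m : ℝ) - m'| ^ p.natDegree ≤
      2 * |((p.eval ((m₀ + m : ℕ) : ℤ) : ℤ) : ℝ) - (p.eval ((m₀ + m' : ℕ) : ℤ) : ℤ)| := by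
  wlog hpos : 0 < p.leadingCoeff generalizing p
  · obtain ⟨m₀, h⟩ := this (-p) (by simpa using hd) (by
      have : p.leadingCoeff ≠ 0 := by
        rw [Ne, Polynomial.leadingCoeff_eq_zero]
        rintro rfl
        simp at hd
      rw [Polynomial.leadingCoeff_neg]
      omega)
    refine ⟨m₀, fun m m' => (le_of_eq ?_).trans ((h m m').trans_eq ?_)⟩
    · rw [Polynomial.natDegree_neg]
    · simp only [Polynomial.eval_neg, Int.cast_neg]
      rw [neg_sub_neg, abs_sub_comm]
  have hinj : Function.Injective (Int.castRingHom ℝ) := Int.cast_injective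
  obtain ⟨x₀, h⟩ := Polynomial.eventually_pow_sub_le (p.map (Int.castRingHom ℝ))
    (by rwa [Polynomial.natDegree_map_eq_of_injective hinj]) (by
      rw [Polynomial.leadingCoeff_map_of_injective hinj]
      exact Int.cast_one (R := ℝ) ▸ Int.cast_le.2 (hpos : 1 ≤ p.leadingCoeff))
  rw [Polynomial.natDegree_map_eq_of_injective hinj] at h
  have heval (n : ℕ) :
      (p.map (Int.castRingHom ℝ)).eval (n : ℝ) = ((p.eval (n : ℤ) : ℤ) : ℝ) := by
    simp
  have key (m m' : ℕ) (hm : m ≤ m') : |(m : ℝ) - m'| ^ p.natDegree ≤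
      2 * |((p.eval ((⌈x₀⌉₊ + m : ℕ) : ℤ) : ℤ) : ℝ) -
        (p.eval ((⌈x₀⌉₊ + m' : ℕ) : ℤ) : ℤ)| := by
    have h1 := h ((⌈x₀⌉₊ + m : ℕ) : ℝ) ((⌈x₀⌉₊ + m' : ℕ) : ℝ)
      ((Nat.le_ceil x₀).trans (by push_cast; linarith [Nat.cast_nonneg (α := ℝ) m]))
      (by exact_mod_cast Nat.add_le_add_left hm _)
    rw [heval, heval] at h1
    have hmm : (m : ℝ) ≤ m' := by exact_mod_cast hm
    rw [abs_sub_comm, abs_of_nonneg (sub_nonneg.2 hmm), abs_sub_comm]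
    refine le_trans (le_of_eq ?_) (h1.trans (mul_le_mul_of_nonneg_left (le_abs_self _) zero_le_two))
    push_cast
    ring
  refine ⟨⌈x₀⌉₊, fun m m' => ?_⟩
  rcases le_total m m' with hm | hm
  · exact key m m' hm
  · rw [abs_sub_comm, abs_sub_comm (((p.eval _ : ℤ) : ℝ))]
    exact key m' m hm

theorem Polynomial.abs_eval_natCast_le (p : Polynomial ℤ) (n : ℕ) :
    |((p.eval (n : ℤ) : ℤ) : ℝ)| ≤
      (∑ i ∈ Finset.range (p.natDegree + 1), |(p.coeff i : ℝ)|) * (1 + n) ^ p.natDegree := by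
  rw [Polynomial.eval_eq_sum_range, Finset.sum_mul]
  push_cast
  refine (Finset.abs_sum_le_sum_abs _ _).trans (Finset.sum_le_sum fun i hi => ?_)
  rw [abs_mul, abs_pow, Nat.abs_cast]
  refine mul_le_mul_of_nonneg_left ?_ (abs_nonneg _)
  calc (n : ℝ) ^ i ≤ (1 + n) ^ i := by gcongr; linarith
    _ ≤ (1 + n) ^ p.natDegree := by
      apply pow_le_pow_right₀ (by linarith [Nat.cast_nonneg (α := ℝ) n])
      exact Nat.lt_succ_iff.1 (Finset.mem_range.1 hi)

/-- After a translation, a nonconstant integer polynomial of degree `d` separates natural numbers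
at least like `x ^ d`, and grows at most like it. -/
theorem Polynomial.exists_shift_separated (p : Polynomial ℤ) (hd : 1 ≤ p.natDegree) :
    ∃ m₀ : ℕ, ∃ C : ℝ, 0 < C ∧
      (∀ m m' : ℕ, (1 + |(m : ℝ) - m'|) ^ p.natDegree ≤ C *
        (1 + |((p.eval ((m₀ + m : ℕ) : ℤ) : ℤ) : ℝ) - (p.eval ((m₀ + m' : ℕ) : ℤ) : ℤ)|)) ∧
      ∀ m : ℕ, |((p.eval ((m₀ + m : ℕ) : ℤ) : ℤ) : ℝ)| ≤ C * (1 + m) ^ p.natDegree := by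
  obtain ⟨m₀, h⟩ := p.exists_nat_abs_sub_pow_le hd
  set d := p.natDegree
  set A : ℝ := ∑ i ∈ Finset.range (d + 1), |(p.coeff i : ℝ)|
  have hA0 : 0 ≤ A := Finset.sum_nonneg fun _ _ => abs_nonneg _
  refine ⟨m₀, 2 ^ d * 2 + A * (1 + m₀) ^ d, by positivity, fun m m' => ?_, fun m => ?_⟩
  · have h1 := h m m'
    set b := |((p.eval ((m₀ + m : ℕ) : ℤ) : ℤ) : ℝ) - (p.eval ((m₀ + m' : ℕ) : ℤ) : ℤ)|
    set t := |(m : ℝ) - m'|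
    have hb : 0 ≤ b := abs_nonneg _
    have ht : 0 ≤ t := abs_nonneg _
    have h2 : (1 + t) ^ d ≤ 2 ^ d * (1 + t ^ d) := by
      have := add_pow_le (zero_le_one' ℝ) ht d
      rw [one_pow] at this
      refine this.trans ?_
      gcongr
      · norm_num
      · lia
    calc (1 + t) ^ d ≤ 2 ^ d * (1 + t ^ d) := h2
      _ ≤ 2 ^ d * (2 * (1 + b)) := by gcongr; linarith
      _ = 2 ^ d * 2 * (1 + b) := by ring
      _ ≤ _ := by gcongr; linarith [show 0 ≤ A * (1 + (m₀ : ℝ)) ^ d by positivity]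
  · calc _ ≤ A * (1 + ((m₀ + m : ℕ) : ℝ)) ^ d := p.abs_eval_natCast_le _
      _ ≤ A * ((1 + m₀) * (1 + m)) ^ d := by
        gcongr
        push_cast
        nlinarith [show (0 : ℝ) ≤ (m₀ : ℝ) * m by positivity]
      _ = A * (1 + m₀) ^ d * (1 + m) ^ d := by rw [mul_pow, mul_assoc]
      _ ≤ _ := by gcongr; linarith [show (0 : ℝ) ≤ 2 ^ d * 2 by positivity]

theorem sum_range_one_add_rpow_neg_le {γ : ℝ} (h0 : 0 ≤ γ) (h1 : γ < 1) (M : ℕ) :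
    ∑ t ∈ Finset.range M, (1 + (t : ℝ)) ^ (-γ) ≤ (M : ℝ) ^ (1 - γ) / (1 - γ) := by
  have hγ : 0 < 1 - γ := by linarith
  induction M with
  | zero => simp [Real.zero_rpow hγ.ne']
  | succ M ih =>
    rw [Finset.sum_range_succ]
    refine (add_le_add_left ih _).trans ?_
    rw [le_div_iff₀ hγ, add_mul, div_mul_cancel₀ _ hγ.ne']
    have hM : (0 : ℝ) < 1 + M := by positivity
    have hb := rpow_one_add_le_one_add_mul_self (s := -(1 / (1 + (M : ℝ))))
      (by rw [neg_le_neg_iff, div_le_one hM]; linarith [Nat.cast_nonneg (α := ℝ) M])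
      hγ.le (by linarith : 1 - γ ≤ 1)
    have e1 : 1 + -(1 / (1 + (M : ℝ))) = M / (1 + M) := by field_simp; ring
    rw [e1, Real.div_rpow (by positivity) hM.le, div_le_iff₀ (by positivity)] at hb
    have e2 : (1 + (M : ℝ)) ^ (-γ) = (1 + (M : ℝ)) ^ (1 - γ) * (1 / (1 + M)) := by
      rw [one_div, ← Real.rpow_neg_one, ← Real.rpow_add hM]
      congr 1
      ring
    push_cast
    rw [e2, add_comm (M : ℝ) 1]
    linarith

theorem sum_range_abs_sub_le {f : ℝ → ℝ} (hf : ∀ t : ℕ, 0 ≤ f t) {M u : ℕ} (hu : u < M) :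
    ∑ v ∈ Finset.range M, f |(u : ℝ) - v| ≤ 2 * ∑ t ∈ Finset.range M, f t := by
  rw [two_mul, ← Finset.sum_range_add_sum_Ico _ hu]
  refine add_le_add ?_ ?_
  · have : ∑ v ∈ Finset.range (u + 1), f |(u : ℝ) - v| = ∑ t ∈ Finset.range (u + 1), f t := by
      rw [← Finset.sum_range_reflect]
      refine Finset.sum_congr rfl fun t ht => ?_
      have : t ≤ u := Nat.lt_succ_iff.1 (Finset.mem_range.1 ht)
      rw [show u + 1 - 1 - t = u - t by lia, Nat.cast_sub this]
      simp
    rw [Nat.succ_eq_add_one, this]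
    exact Finset.sum_le_sum_of_subset_of_nonneg (Finset.range_mono hu) fun i _ _ => hf i
  · rw [Finset.sum_Ico_eq_sum_range]
    refine (Finset.sum_le_sum_of_subset_of_nonneg (Finset.range_mono
      (show M - u.succ ≤ M - 1 by lia)) fun i _ _ => ?_).trans ?_
    · rw [show |(u : ℝ) - ((u.succ + i : ℕ) : ℝ)| = ((i + 1 : ℕ) : ℝ) by
        push_cast; rw [abs_sub_comm, abs_of_nonneg] <;> [ring; linarith]]
      exact hf _
    · have : M = (M - 1) + 1 := by lia
      conv_rhs => rw [this, Finset.sum_range_succ']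
      refine le_add_of_le_of_nonneg (Finset.sum_le_sum fun i _ => le_of_eq ?_) (hf 0)
      congr 1
      push_cast
      rw [abs_sub_comm, abs_of_nonneg] <;> [ring; linarith]

theorem sq_card_le_card_image_mul_energy {α β : Type*} [DecidableEq β] (A : Finset α)
    (f : α → β) :
    A.card ^ 2 ≤ (A.image f).card * ∑ x ∈ A, ∑ y ∈ A, if f x = f y then 1 else 0 := by
  have h1 : A.card = ∑ z ∈ A.image f, (A.filter fun x => f x = z).card :=
    Finset.card_eq_sum_card_image f A
  have h2 : ∑ x ∈ A, ∑ y ∈ A, (if f x = f y then 1 else 0) =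
      ∑ z ∈ A.image f, (A.filter fun x => f x = z).card ^ 2 := by
    have h3 (x : α) : ∑ y ∈ A, (if f x = f y then 1 else 0) =
        (A.filter fun y => f y = f x).card := by
      simp_rw [Finset.card_filter, eq_comm]
    rw [Finset.sum_congr rfl fun x _ => h3 x,
      Finset.sum_comp (fun z => (A.filter fun y => f y = z).card) f]
    simp [sq]
  rw [h2]
  conv_lhs => rw [h1]
  exact sq_sum_le_card_mul_sum_sq

theorem le_prod_rpow_of_forall_le {ι : Type*} [Fintype ι] {x : ℝ} (hx : 0 ≤ x) (y w : ι → ℝ)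
    (hw : ∀ i, 0 ≤ w i) (hw1 : ∑ i, w i = 1) (h : ∀ i, x ≤ y i) : x ≤ ∏ i, y i ^ w i := by
  calc x = x ^ (∑ i, w i) := by rw [hw1, Real.rpow_one]
    _ = ∏ i, x ^ w i := Real.rpow_sum_of_nonneg hx fun i _ => hw i
    _ ≤ _ := Finset.prod_le_prod (fun i _ => Real.rpow_nonneg hx _)
      fun i _ => Real.rpow_le_rpow hx (h i) (hw i)

theorem volume_box_inter_slab_le {K : ℕ} {L : ℝ} (hL : 0 < L) (b : Fin (K + 1) → ℝ) (c r : ℝ)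
    (hr : 0 ≤ r) (j : Fin (K + 1)) (hb : b j ≠ 0) :
    volume {l : Fin (K + 1) → ℝ | (∀ i, l i ∈ Set.Icc (-L) L) ∧ |c + ∑ i, l i * b i| ≤ r} ≤
      ENNReal.ofReal (2 * r / |b j| * (2 * L) ^ K) := by
  set T : (Fin K → ℝ) → ℝ := fun y => c + ∑ i, y i * b (j.succAbove i)
  set B : Set (Fin K → ℝ) := Set.univ.pi fun _ => Set.Icc (-L) L with hB
  set S : Set (ℝ × (Fin K → ℝ)) := {z | |z.1 * b j + T z.2| ≤ r ∧ z.2 ∈ B}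
  have hTm : Continuous T := by fun_prop
  have hBm : MeasurableSet B := MeasurableSet.univ_pi fun _ => measurableSet_Icc
  have hSm : MeasurableSet S := by
    refine MeasurableSet.inter ?_ (measurable_snd hBm)
    exact measurableSet_le (f := fun z : ℝ × (Fin K → ℝ) => |z.1 * b j + T z.2|)
      (by fun_prop) measurable_const
  have hsub : {l : Fin (K + 1) → ℝ | (∀ i, l i ∈ Set.Icc (-L) L) ∧ |c + ∑ i, l i * b i| ≤ r} ⊆
      MeasurableEquiv.piFinSuccAbove (fun _ => ℝ) j ⁻¹' S := by
    rintro l ⟨hl, h⟩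
    refine ⟨?_, fun i _ => hl _⟩
    rw [Fin.sum_univ_succAbove _ j] at h
    rw [← add_assoc, add_comm c, add_assoc] at h
    exact h
  refine (measure_mono hsub).trans ?_
  rw [(volume_preserving_piFinSuccAbove (fun _ => ℝ) j).measure_preimage hSm.nullMeasurableSet,
    Measure.volume_eq_prod, Measure.prod_apply_symm hSm]
  have hslice (y : Fin K → ℝ) : volume ((fun x => (x, y)) ⁻¹' S) ≤
      B.indicator (fun _ => ENNReal.ofReal (2 * r / |b j|)) y := by
    by_cases hy : y ∈ B
    · rw [Set.indicator_of_mem hy]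
      have : (fun x => (x, y)) ⁻¹' S ⊆ Metric.closedBall (-(T y / b j)) (r / |b j|) := by
        rintro x ⟨hx, -⟩
        rw [Metric.mem_closedBall, Real.dist_eq, le_div_iff₀ (abs_pos.2 hb), ← abs_mul]
        refine le_trans (le_of_eq ?_) hx
        congr 1
        field_simp
        ring
      refine (measure_mono this).trans_eq ?_
      rw [Real.volume_closedBall]
      congr 1
      ring
    · have : (fun x => (x, y)) ⁻¹' S = ∅ :=
        Set.eq_empty_of_forall_notMem fun x hx => hy hx.2
      simp [this]
  refine (lintegral_mono hslice).trans ?_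
  rw [lintegral_indicator hBm, setLIntegral_const, hB, volume_pi_pi]
  simp only [Real.volume_Icc, Finset.prod_const, Finset.card_univ, Fintype.card_fin]
  rw [← ENNReal.ofReal_pow (by linarith), ← ENNReal.ofReal_mul (by positivity)]
  exact le_of_eq (by ring_nf)

/-- The sum `a₀ + ⌊λ₁ a₁⌋ + ⋯ + ⌊λₖ aₖ⌋`. -/
def floorSum {k : ℕ} (l : Fin k → ℝ) (a : Fin (k + 1) → ℤ) : ℤ :=
  a 0 + ∑ i : Fin k, ⌊l i * ((a i.succ : ℤ) : ℝ)⌋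

theorem measurable_floorSum {k : ℕ} (a : Fin (k + 1) → ℤ) :
    Measurable fun l : Fin k → ℝ => floorSum l a := by
  unfold floorSum
  refine measurable_const.add (Finset.measurable_sum _ fun i _ => ?_)
  exact ((measurable_pi_apply i).mul_const _).floor

theorem abs_add_sum_mul_le_of_floorSum_eq {k : ℕ} {l : Fin k → ℝ} {a a' : Fin (k + 1) → ℤ}
    (h : floorSum l a = floorSum l a') :
    |((a 0 : ℝ) - a' 0) + ∑ i : Fin k, l i * ((a i.succ : ℝ) - a' i.succ)| ≤ k := by
  have h' : (a 0 : ℝ) + ∑ i : Fin k, ((⌊l i * (a i.succ : ℝ)⌋ : ℤ) : ℝ) =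
      a' 0 + ∑ i : Fin k, ((⌊l i * (a' i.succ : ℝ)⌋ : ℤ) : ℝ) := by
    exact_mod_cast h
  have e : ((a 0 : ℝ) - a' 0) + ∑ i : Fin k, l i * ((a i.succ : ℝ) - a' i.succ) =
      ∑ i : Fin k, (Int.fract (l i * (a i.succ : ℝ)) - Int.fract (l i * (a' i.succ : ℝ))) := by
    simp only [Int.fract, mul_sub, Finset.sum_sub_distrib]
    linarith
  rw [e]
  refine (Finset.abs_sum_le_sum_abs _ _).trans ((Finset.sum_le_sum (g := fun _ => (1 : ℝ))
    fun i _ => ?_).trans_eq (by simp))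
  rw [abs_le]
  constructor <;>
  linarith [Int.fract_nonneg (l i * (a i.succ : ℝ)), Int.fract_lt_one (l i * (a i.succ : ℝ)),
    Int.fract_nonneg (l i * (a' i.succ : ℝ)), Int.fract_lt_one (l i * (a' i.succ : ℝ))]

theorem abs_floorSum_le {k : ℕ} {L R : ℝ} (l : Fin k → ℝ) (a : Fin (k + 1) → ℤ)
    (hL : ∀ i, |l i| ≤ L) (hR : ∀ i, |(a i : ℝ)| ≤ R) :
    |(floorSum l a : ℝ)| ≤ R + k * (L * R + 1) := by
  unfold floorSum
  push_cast
  refine (abs_add_le _ _).trans (add_le_add (hR 0) ?_)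
  refine (Finset.abs_sum_le_sum_abs _ _).trans ((Finset.sum_le_sum (g := fun _ => L * R + 1)
    fun i _ => ?_).trans_eq (by simp [mul_add]))
  have h1 : |l i * (a i.succ : ℝ)| ≤ L * R := by
    rw [abs_mul]
    exact mul_le_mul (hL i) (hR _) (abs_nonneg _) ((abs_nonneg _).trans (hL i))
  rw [abs_le] at h1 ⊢
  constructor <;>
  linarith [Int.floor_le (l i * (a i.succ : ℝ)), Int.lt_floor_add_one (l i * (a i.succ : ℝ))]

theorem volume_box_inter_collision_le_succ {K : ℕ} {L : ℝ} (hL : 0 < L)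
    (a a' : Fin (K + 2) → ℤ) (j : Fin (K + 1)) :
    volume {l : Fin (K + 1) → ℝ | (∀ i, l i ∈ Set.Icc (-L) L) ∧ floorSum l a = floorSum l a'} ≤
      ENNReal.ofReal ((2 * L) ^ K * (2 * L + 4 * (K + 1)) /
        (1 + |(a j.succ : ℝ) - a' j.succ|)) := by
  by_cases hj : a j.succ = a' j.succ
  · have hsub : {l : Fin (K + 1) → ℝ | (∀ i, l i ∈ Set.Icc (-L) L) ∧
        floorSum l a = floorSum l a'} ⊆ Set.univ.pi fun _ => Set.Icc (-L) L :=
      fun l hl i _ => hl.1 i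
    refine (measure_mono hsub).trans ?_
    rw [volume_pi_pi]
    simp only [Real.volume_Icc, Finset.prod_const, Finset.card_univ, Fintype.card_fin]
    rw [← ENNReal.ofReal_pow (by linarith), hj]
    refine ENNReal.ofReal_le_ofReal ?_
    rw [sub_self, abs_zero, add_zero, div_one, pow_succ]
    have : 0 ≤ (2 * L) ^ K := by positivity
    refine (le_of_eq ?_).trans (mul_le_mul_of_nonneg_left
      (by linarith [Nat.cast_nonneg (α := ℝ) K] : 2 * L ≤ 2 * L + 4 * (K + 1)) this)
    ring
  · have hb : (a j.succ : ℝ) - a' j.succ ≠ 0 := sub_ne_zero.2 (by exact_mod_cast hj)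
    have hb1 : 1 ≤ |(a j.succ : ℝ) - a' j.succ| := by
      have : 1 ≤ |a j.succ - a' j.succ| := Int.one_le_abs (sub_ne_zero.2 hj)
      exact_mod_cast this
    have hsub : {l : Fin (K + 1) → ℝ | (∀ i, l i ∈ Set.Icc (-L) L) ∧
        floorSum l a = floorSum l a'} ⊆ {l | (∀ i, l i ∈ Set.Icc (-L) L) ∧
          |((a 0 : ℝ) - a' 0) + ∑ i : Fin (K + 1), l i * ((a i.succ : ℝ) - a' i.succ)| ≤
            ((K + 1 : ℕ) : ℝ)} :=
      fun l hl => ⟨hl.1, abs_add_sum_mul_le_of_floorSum_eq hl.2⟩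
    refine (measure_mono hsub).trans ((volume_box_inter_slab_le hL
      (fun i => (a i.succ : ℝ) - a' i.succ) _ _ (Nat.cast_nonneg _) j hb).trans ?_)
    refine ENNReal.ofReal_le_ofReal ?_
    have hP : 0 ≤ (2 * L) ^ K := by positivity
    set β := |(a j.succ : ℝ) - a' j.succ|
    have hβ : 0 < β := by linarith
    rw [mul_comm, mul_div_assoc ((2 * L) ^ K)]
    refine mul_le_mul_of_nonneg_left ?_ hP
    rw [div_le_div_iff₀ hβ (by linarith)]
    push_cast
    nlinarith [mul_nonneg (Nat.cast_nonneg (α := ℝ) K) (sub_nonneg.2 hb1), mul_pos hL hβ]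

theorem exists_volume_box_inter_collision_le (K : ℕ) {L : ℝ} (hL : 0 < L) :
    ∃ C : ℝ, 0 < C ∧ ∀ (a a' : Fin (K + 2) → ℤ) (j : Fin (K + 2)),
      volume {l : Fin (K + 1) → ℝ | (∀ i, l i ∈ Set.Icc (-L) L) ∧
        floorSum l a = floorSum l a'} ≤
        ENNReal.ofReal (C / (1 + |(a j : ℝ) - a' j|)) := by
  obtain ⟨C₁, hC₁0, hC₁⟩ : ∃ C₁ : ℝ, 0 < C₁ ∧ ∀ (a a' : Fin (K + 2) → ℤ) (j : Fin (K + 1)),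
      volume {l : Fin (K + 1) → ℝ | (∀ i, l i ∈ Set.Icc (-L) L) ∧
        floorSum l a = floorSum l a'} ≤
        ENNReal.ofReal (C₁ / (1 + |(a j.succ : ℝ) - a' j.succ|)) :=
    ⟨_, by positivity, volume_box_inter_collision_le_succ hL⟩
  set k : ℝ := ((K + 1 : ℕ) : ℝ) with hk
  have hk0 : 0 < k := by positivity
  have hq : 1 ≤ 1 + k + k * L := by nlinarith
  refine ⟨C₁ * (1 + k + k * L), by positivity, fun a a' j => ?_⟩
  refine Fin.cases ?_ (fun j => ?_) j
  · rcases Set.eq_empty_or_nonempty {l : Fin (K + 1) → ℝ | (∀ i, l i ∈ Set.Icc (-L) L) ∧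
      floorSum l a = floorSum l a'} with h | ⟨l, hl, hfl⟩
    · rw [h, measure_empty]
      exact zero_le
    · obtain ⟨i, hi⟩ := Finite.exists_max fun i : Fin (K + 1) => |(a i.succ : ℝ) - a' i.succ|
      refine (hC₁ a a' i).trans
        (ENNReal.ofReal_le_ofReal ?_)
      set Δ := |(a i.succ : ℝ) - a' i.succ|
      have hΔ : 0 ≤ Δ := abs_nonneg _
      have h1 := abs_add_sum_mul_le_of_floorSum_eq hfl
      have h2 : |∑ i : Fin (K + 1), l i * ((a i.succ : ℝ) - a' i.succ)| ≤ k * (L * Δ) := by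
        refine (Finset.abs_sum_le_sum_abs _ _).trans ((Finset.sum_le_sum
          (g := fun _ => L * Δ) fun i _ => ?_).trans_eq (by simp [hk]))
        rw [abs_mul]
        exact mul_le_mul (abs_le.2 (hl i)) (hi i) (abs_nonneg _) hL.le
      have h3 : |(a 0 : ℝ) - a' 0| ≤ k + k * (L * Δ) := by
        rw [abs_le] at h1 h2 ⊢
        constructor <;> linarith
      rw [div_le_div_iff₀ (by positivity) (by positivity), mul_assoc]
      refine mul_le_mul_of_nonneg_left ?_ hC₁0.le
      nlinarith [mul_nonneg hk0.le hΔ, mul_pos hk0 hL]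
  · refine (hC₁ a a' j).trans
      (ENNReal.ofReal_le_ofReal ?_)
    gcongr
    exact le_mul_of_one_le_right hC₁0.le hq

theorem sum_piFinset_prod_rpow_le {ι : Type*} [Fintype ι] [DecidableEq ι] {γ : ℝ} (h0 : 0 ≤ γ)
    (h1 : γ < 1) (M : ι → ℕ) :
    ∑ x ∈ Fintype.piFinset fun j => Finset.range (M j),
      ∑ y ∈ Fintype.piFinset fun j => Finset.range (M j),
        ∏ j, (1 + |(x j : ℝ) - y j|) ^ (-γ) ≤
      (2 / (1 - γ)) ^ Fintype.card ι * (((∏ j, M j : ℕ) : ℝ) * ((∏ j, M j : ℕ) : ℝ) ^ (1 - γ)) := by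
  have hinner : ∀ x ∈ Fintype.piFinset fun j => Finset.range (M j),
      ∑ y ∈ Fintype.piFinset fun j => Finset.range (M j),
        ∏ j, (1 + |(x j : ℝ) - y j|) ^ (-γ) ≤
      (2 / (1 - γ)) ^ Fintype.card ι * ((∏ j, M j : ℕ) : ℝ) ^ (1 - γ) := by
    intro x hx
    rw [← Finset.prod_univ_sum (fun j => Finset.range (M j))
      (fun j v => (1 + |(x j : ℝ) - (v : ℝ)|) ^ (-γ))]
    have : (2 / (1 - γ)) ^ Fintype.card ι * ((∏ j, M j : ℕ) : ℝ) ^ (1 - γ) =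
        ∏ j, 2 / (1 - γ) * (M j : ℝ) ^ (1 - γ) := by
      rw [Finset.prod_mul_distrib, Finset.prod_const, Finset.card_univ, Nat.cast_prod,
        Real.finsetProd_rpow _ _ fun i _ => Nat.cast_nonneg _]
    rw [this]
    refine Finset.prod_le_prod (fun j _ => Finset.sum_nonneg fun v _ => by positivity)
      fun j _ => ?_
    have hxj : x j < M j := Finset.mem_range.1 (Fintype.mem_piFinset.1 hx j)
    refine (sum_range_abs_sub_le (f := fun t => (1 + t) ^ (-γ))
      (fun t => by positivity) hxj).trans ?_
    refine (mul_le_mul_of_nonneg_left (sum_range_one_add_rpow_neg_le h0 h1 (M j))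
      zero_le_two).trans_eq ?_
    ring
  refine (Finset.sum_le_sum hinner).trans_eq ?_
  rw [Finset.sum_const, Fintype.card_piFinset, nsmul_eq_mul]
  simp only [Finset.card_range]
  ring

theorem exists_frequently_le_of_setLIntegral_le {Ω : Type*} [MeasurableSpace Ω] {μ : Measure Ω}
    {B : Set Ω} (hB : MeasurableSet B) {f : ℕ → Ω → ℝ≥0∞} (hf : ∀ n, Measurable (f n))
    {C : ℝ≥0∞} (hC : C ≠ ⊤) (h : ∀ n, ∫⁻ x in B, f n x ∂μ ≤ C) :
    ∀ᵐ x ∂μ, x ∈ B → ∃ N : ℕ, ∃ᶠ n in atTop, f n x ≤ N := by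
  rw [← ae_restrict_iff' hB]
  have hfin : ∫⁻ x in B, liminf (fun n => f n x) atTop ∂μ ≠ ⊤ := by
    refine ((lintegral_liminf_le hf).trans_lt (lt_of_le_of_lt ?_ hC.lt_top)).ne
    exact liminf_le_of_le (by isBoundedDefault) fun b hb => by
      obtain ⟨n, hn⟩ := hb.exists
      exact hn.trans (h n)
  filter_upwards [ae_lt_top (Measurable.liminf hf) hfin] with x hx
  obtain ⟨N, hN⟩ := ENNReal.exists_nat_gt hx.ne
  exact ⟨N, (frequently_lt_of_liminf_lt (by isBoundedDefault) hN).mono fun n hn => hn.le⟩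

/-- The number of pairs of points of a box of side lengths `M j` at which the sums
`a₀ + ⌊λ₁ a₁⌋ + ⋯ + ⌊λₖ aₖ⌋` coincide. -/
def floorSumEnergy {k : ℕ} (a : Fin (k + 1) → ℕ → ℤ) (M : Fin (k + 1) → ℕ) (l : Fin k → ℝ) : ℕ :=
  ∑ x ∈ Fintype.piFinset fun j => Finset.range (M j),
    ∑ y ∈ Fintype.piFinset fun j => Finset.range (M j),
      if floorSum l (fun j => a j (x j)) = floorSum l (fun j => a j (y j)) then 1 else 0

theorem floorSumEnergy_cast {k : ℕ} (a : Fin (k + 1) → ℕ → ℤ) (M : Fin (k + 1) → ℕ)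
    (l : Fin k → ℝ) :
    (floorSumEnergy a M l : ℝ≥0∞) = ∑ x ∈ Fintype.piFinset fun j => Finset.range (M j),
      ∑ y ∈ Fintype.piFinset fun j => Finset.range (M j),
        {l | floorSum l (fun j => a j (x j)) = floorSum l (fun j => a j (y j))}.indicator 1 l := by
  simp [floorSumEnergy, Set.indicator_apply]

theorem measurableSet_floorSum_eq {k : ℕ} (a a' : Fin (k + 1) → ℤ) :
    MeasurableSet {l : Fin k → ℝ | floorSum l a = floorSum l a'} :=
  measurableSet_eq_fun (measurable_floorSum a) (measurable_floorSum a')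

theorem measurable_floorSumEnergy {k : ℕ} (a : Fin (k + 1) → ℕ → ℤ) (M : Fin (k + 1) → ℕ) :
    Measurable fun l => (floorSumEnergy a M l : ℝ≥0∞) := by
  simp_rw [floorSumEnergy_cast]
  exact Finset.measurable_sum _ fun x _ => Finset.measurable_sum _ fun y _ =>
    measurable_one.indicator (measurableSet_floorSum_eq _ _)

/-- Sequences which are separated at scale `m ^ d` and which grow at most like `m ^ d`. -/
structure PolynomialLike (d : ℕ) (C : ℝ) (a : ℕ → ℤ) : Prop where
  separated : ∀ m m' : ℕ, (1 + |(m : ℝ) - m'|) ^ d ≤ C * (1 + |(a m : ℝ) - a m'|)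
  growth : ∀ m : ℕ, |(a m : ℝ)| ≤ C * (1 + m) ^ d

theorem PolynomialLike.mono {d : ℕ} {C C' : ℝ} {a : ℕ → ℤ} (h : PolynomialLike d C a)
    (hC : C ≤ C') : PolynomialLike d C' a where
  separated m m' := (h.separated m m').trans (by gcongr)
  growth m := (h.growth m).trans (by gcongr)

theorem setLIntegral_floorSumEnergy_le {K : ℕ} {a : Fin (K + 2) → ℕ → ℤ} {d e : Fin (K + 2) → ℕ}
    {D : ℕ} {C : ℝ} (hC : 0 < C) (ha : ∀ j, PolynomialLike (d j) C (a j))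
    (he : ∀ j, e j * d j = D) (hD : D < ∑ j, e j) {L : ℝ} (hL : 0 < L) :
    ∃ C' : ℝ, ∀ n : ℕ,
      ∫⁻ l in {l : Fin (K + 1) → ℝ | ∀ i, l i ∈ Set.Icc (-L) L},
        (floorSumEnergy a (fun j => n ^ e j) l : ℝ≥0∞) ≤
      ENNReal.ofReal (C' * n ^ (2 * ∑ j, e j - D)) := by
  obtain ⟨C₁, hC₁0, hC₁⟩ := exists_volume_box_inter_collision_le K hL
  set S := ∑ j, e j with hS
  have hS0 : (0 : ℝ) < S := by exact_mod_cast (Nat.zero_le D).trans_lt hD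
  set γ : ℝ := (D : ℝ) / S with hγ
  have hγ0 : 0 ≤ γ := by positivity
  have hγ1 : γ < 1 := by
    rw [hγ, div_lt_one hS0]
    exact_mod_cast hD
  refine ⟨C₁ * C * (2 / (1 - γ)) ^ Fintype.card (Fin (K + 2)), fun n => ?_⟩
  have hpair (x y : Fin (K + 2) → ℕ) :
      volume {l : Fin (K + 1) → ℝ | (∀ i, l i ∈ Set.Icc (-L) L) ∧
        floorSum l (fun j => a j (x j)) = floorSum l (fun j => a j (y j))} ≤
      ENNReal.ofReal (C₁ * C * ∏ j, (1 + |(x j : ℝ) - y j|) ^ (-γ)) := by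
    set V := volume {l : Fin (K + 1) → ℝ | (∀ i, l i ∈ Set.Icc (-L) L) ∧
        floorSum l (fun j => a j (x j)) = floorSum l (fun j => a j (y j))}
    have hV := hC₁ (fun j => a j (x j)) (fun j => a j (y j))
    rw [← ENNReal.ofReal_toReal (ne_top_of_le_ne_top ENNReal.ofReal_ne_top (hV 0) : V ≠ ⊤)]
    refine ENNReal.ofReal_le_ofReal ?_
    have hw1 : ∑ j, (e j : ℝ) / S = 1 := by
      rw [← Finset.sum_div, ← Nat.cast_sum, ← hS, div_self hS0.ne']
    have hle (j : Fin (K + 2)) : V.toReal ≤ C₁ * C * ((1 + |(x j : ℝ) - y j|) ^ d j)⁻¹ := by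
      refine (ENNReal.toReal_le_of_le_ofReal (by positivity) (hV j)).trans ?_
      rw [← div_eq_mul_inv, div_le_div_iff₀ (by positivity) (by positivity), mul_assoc]
      exact mul_le_mul_of_nonneg_left ((ha j).separated (x j) (y j)) hC₁0.le
    refine (le_prod_rpow_of_forall_le ENNReal.toReal_nonneg _ (fun j => (e j : ℝ) / S)
      (fun j => by positivity) hw1 hle).trans_eq ?_
    have hfac (j : Fin (K + 2)) :
        (C₁ * C * ((1 + |(x j : ℝ) - y j|) ^ d j)⁻¹) ^ ((e j : ℝ) / S) =
          (C₁ * C) ^ ((e j : ℝ) / S) * (1 + |(x j : ℝ) - y j|) ^ (-γ) := by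
      rw [Real.mul_rpow (by positivity) (by positivity), Real.inv_rpow (by positivity),
        ← Real.rpow_natCast, ← Real.rpow_mul (by positivity), ← Real.rpow_neg (by positivity)]
      congr 3
      rw [hγ, ← he j]
      push_cast
      ring
    simp_rw [hfac]
    rw [Finset.prod_mul_distrib, ← Real.rpow_sum_of_pos (by positivity), hw1, Real.rpow_one]
  have hBm : MeasurableSet {l : Fin (K + 1) → ℝ | ∀ i, l i ∈ Set.Icc (-L) L} := by
    rw [Set.ofPred_forall]
    exact MeasurableSet.iInter fun i => measurable_pi_apply i measurableSet_Icc
  have hint (x y : Fin (K + 2) → ℕ) :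
      ∫⁻ l in {l : Fin (K + 1) → ℝ | ∀ i, l i ∈ Set.Icc (-L) L},
        {l | floorSum l (fun j => a j (x j)) = floorSum l (fun j => a j (y j))}.indicator 1 l ≤
      ENNReal.ofReal (C₁ * C * ∏ j, (1 + |(x j : ℝ) - y j|) ^ (-γ)) := by
    refine le_trans (le_of_eq ?_) (hpair x y)
    rw [lintegral_indicator_one (measurableSet_floorSum_eq _ _),
      Measure.restrict_apply (measurableSet_floorSum_eq _ _), Set.inter_comm]
    rfl
  have hm (x y : Fin (K + 2) → ℕ) : Measurable
      ({l : Fin (K + 1) → ℝ | floorSum l (fun j => a j (x j)) =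
        floorSum l (fun j => a j (y j))}.indicator (1 : (Fin (K + 1) → ℝ) → ℝ≥0∞)) :=
    measurable_one.indicator (measurableSet_floorSum_eq _ _)
  simp_rw [floorSumEnergy_cast]
  rw [lintegral_finsetSum _ fun x _ => Finset.measurable_sum _ fun y _ => hm x y]
  simp_rw [lintegral_finsetSum _ fun y _ => hm _ y]
  refine (Finset.sum_le_sum fun x _ => Finset.sum_le_sum fun y _ => hint x y).trans ?_
  have hnn (x y : Fin (K + 2) → ℕ) :
      0 ≤ C₁ * C * ∏ j, (1 + |(x j : ℝ) - y j|) ^ (-γ) := by positivity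
  simp_rw [← ENNReal.ofReal_sum_of_nonneg fun y _ => hnn _ y]
  rw [← ENNReal.ofReal_sum_of_nonneg fun x _ => Finset.sum_nonneg fun y _ => hnn x y]
  refine ENNReal.ofReal_le_ofReal ?_
  simp_rw [← Finset.mul_sum]
  rw [mul_assoc (C₁ * C)]
  refine mul_le_mul_of_nonneg_left ((sum_piFinset_prod_rpow_le hγ0 hγ1 _).trans_eq ?_)
    (by positivity)
  rw [Finset.prod_pow_eq_pow_sum, ← hS, Nat.cast_pow]
  congr 1
  have : ((n : ℝ) ^ S) ^ (1 - γ) = (n : ℝ) ^ (S - D) := by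
    rw [← Real.rpow_natCast, ← Real.rpow_mul (Nat.cast_nonneg n), ← Real.rpow_natCast,
      Nat.cast_sub hD.le]
    congr 1
    rw [hγ]
    field_simp
  rw [this, ← pow_add]
  congr 1
  lia

theorem upperBanach_pos_of_frequently_le {E : Set ℤ} {c : ℝ} (hc : 0 < c) {I : ℕ → ℤ × ℤ}
    (hI : Tendsto (fun n => (I n).2 - (I n).1) atTop atTop)
    (h : ∃ᶠ n in atTop,
      c ≤ (icount E (I n).1 (I n).2 : ℝ) / (((I n).2 - (I n).1 : ℤ) : ℝ)) :
    0 < upperBanach E := by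
  refine hc.trans_le (le_limsup_of_frequently_le ((tendsto_comap_iff.2 hI).frequently h) ?_)
  refine isBoundedUnder_of_eventually_le (a := (1 : ℝ)) ?_
  filter_upwards [tendsto_comap.eventually_gt_atTop (0 : ℤ)] with p hp
  rw [div_le_one (by exact_mod_cast hp)]
  have h1 : icount E p.1 p.2 ≤ (Set.Ioc p.1 p.2).ncard :=
    Set.ncard_le_ncard Set.inter_subset_right (Set.finite_Ioc _ _)
  rw [← Finset.coe_Ioc, Set.ncard_coe_finset, Int.card_Ioc] at h1
  have h2 : (icount E p.1 p.2 : ℤ) ≤ p.2 - p.1 := by lia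
  exact_mod_cast h2

theorem upperBanach_pos_of_frequently_energy_le {k : ℕ} {a : Fin (k + 1) → ℕ → ℤ}
    {d e : Fin (k + 1) → ℕ} {D : ℕ} {C : ℝ} (hC : 0 < C)
    (ha : ∀ j, PolynomialLike (d j) C (a j)) (he : ∀ j, e j * d j = D) (hD0 : D ≠ 0)
    (hD : D ≤ ∑ j, e j) {L : ℝ} {l : Fin k → ℝ} (hl : ∀ i, |l i| ≤ L) (hL : 0 ≤ L) {N : ℕ}
    (hN : ∃ᶠ n : ℕ in atTop,
      floorSumEnergy a (fun j => n ^ e j) l ≤ N * n ^ (2 * ∑ j, e j - D)) {E : Set ℤ}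
    (hE : ∀ x : Fin (k + 1) → ℕ, floorSum l (fun j => a j (x j)) ∈ E) :
    0 < upperBanach E := by
  set S := ∑ j, e j with hS
  obtain ⟨R, hR⟩ := exists_nat_ge (C + k * (L * C + 1))
  have hR0 : (0 : ℝ) ≤ R := Nat.cast_nonneg R
  have hc : (0 : ℝ) < 1 / ((2 * R + 1) * (N + 1)) := by positivity
  refine upperBanach_pos_of_frequently_le hc
    (I := fun n => (-(R * (n : ℤ) ^ D) - 1, R * (n : ℤ) ^ D)) ?_ ?_
  · refine tendsto_atTop_mono' _ ((eventually_ge_atTop 1).mono fun n hn => ?_)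
      tendsto_natCast_atTop_atTop
    have hn' : (1 : ℤ) ≤ n := by exact_mod_cast hn
    have h1 : (n : ℤ) ≤ (n : ℤ) ^ D := le_self_pow₀ hn' hD0
    have hR1 : (1 : ℤ) ≤ R := by
      have : (0 : ℝ) < R := lt_of_lt_of_le (by positivity) hR
      exact_mod_cast this
    change (n : ℤ) ≤ R * (n : ℤ) ^ D - (-(R * (n : ℤ) ^ D) - 1)
    nlinarith
  · refine (hN.and_eventually (eventually_ge_atTop 1)).mono fun n ⟨hn, hn1⟩ => ?_
    set A := Fintype.piFinset fun j => Finset.range (n ^ e j) with hA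
    set f : (Fin (k + 1) → ℕ) → ℤ := fun x => floorSum l fun j => a j (x j)
    have hnR : (1 : ℝ) ≤ n := by exact_mod_cast hn1
    have hnD : (1 : ℝ) ≤ (n : ℝ) ^ D := one_le_pow₀ hnR
    have hsub : ((A.image f : Finset ℤ) : Set ℤ) ⊆
        E ∩ Set.Ioc (-(R * (n : ℤ) ^ D) - 1) (R * (n : ℤ) ^ D) := by
      intro z hz
      obtain ⟨x, hx, rfl⟩ := Finset.mem_image.1 (Finset.mem_coe.1 hz)
      refine ⟨hE x, ?_⟩
      have hbound (j : Fin (k + 1)) : |(a j (x j) : ℝ)| ≤ C * n ^ D := by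
        refine ((ha j).growth _).trans (mul_le_mul_of_nonneg_left ?_ hC.le)
        rw [← he j, pow_mul]
        refine pow_le_pow_left₀ (by positivity) ?_ _
        have : x j < n ^ e j := Finset.mem_range.1 (Fintype.mem_piFinset.1 hx j)
        have : 1 + x j ≤ n ^ e j := by lia
        exact_mod_cast this
      have h1 := abs_floorSum_le l (fun j => a j (x j)) hl hbound
      have h2 : |(f x : ℝ)| ≤ R * (n : ℝ) ^ D := by
        refine h1.trans ((?_ : _ ≤ (C + k * (L * C + 1)) * (n : ℝ) ^ D).trans
          (mul_le_mul_of_nonneg_right hR (by positivity)))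
        have : (k : ℝ) ≤ k * (n : ℝ) ^ D := le_mul_of_one_le_right (Nat.cast_nonneg k) hnD
        linarith
      have h3 : |f x| ≤ R * (n : ℤ) ^ D := by exact_mod_cast h2
      rw [abs_le] at h3
      exact ⟨by linarith, h3.2⟩
    have hcard : (A.image f).card ≤ icount E (-(R * (n : ℤ) ^ D) - 1) (R * (n : ℤ) ^ D) := by
      rw [← Set.ncard_coe_finset]
      exact Set.ncard_le_ncard hsub ((Set.finite_Ioc _ _).inter_of_right _)
    have hAcard : A.card = n ^ S := by
      rw [hA, Fintype.card_piFinset]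
      simp only [Finset.card_range]
      rw [Finset.prod_pow_eq_pow_sum]
    have hcs := (sq_card_le_card_image_mul_energy A f).trans
      (Nat.mul_le_mul_left (A.image f).card hn)
    have hq : n ^ (2 * S - D) * n ^ D = (n ^ S) ^ 2 := by
      rw [← pow_add, ← pow_mul]
      congr 1
      lia
    have hpos : 0 < n ^ (2 * S - D) := by positivity
    have hmain : n ^ D ≤ (A.image f).card * N := by
      refine Nat.le_of_mul_le_mul_left ?_ hpos
      rw [hq, ← hAcard]
      refine hcs.trans_eq ?_
      ring
    have hmain' : (n : ℝ) ^ D ≤ icount E (-(R * (n : ℤ) ^ D) - 1) (R * (n : ℤ) ^ D) * (N + 1) := by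
      have : n ^ D ≤ icount E (-(R * (n : ℤ) ^ D) - 1) (R * (n : ℤ) ^ D) * (N + 1) :=
        hmain.trans (Nat.mul_le_mul hcard (Nat.le_succ N))
      exact_mod_cast this
    have hlen : (((R * (n : ℤ) ^ D - (-(R * (n : ℤ) ^ D) - 1) : ℤ)) : ℝ) ≤
        (2 * R + 1) * (n : ℝ) ^ D := by
      push_cast
      linarith
    have hlen0 : (0 : ℝ) < ((R * (n : ℤ) ^ D - (-(R * (n : ℤ) ^ D) - 1) : ℤ) : ℝ) := by
      push_cast
      have : 0 ≤ (R : ℝ) * (n : ℝ) ^ D := by positivity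
      linarith
    rw [div_le_div_iff₀ (by positivity) hlen0, one_mul]
    refine hlen.trans ((mul_le_mul_of_nonneg_left hmain' (by positivity)).trans_eq ?_)
    ring

theorem ae_upperBanach_pos {K : ℕ} {a : Fin (K + 2) → ℕ → ℤ} {d : Fin (K + 2) → ℕ} {C : ℝ}
    (hC : 0 < C) (ha : ∀ j, PolynomialLike (d j) C (a j)) (hd : ∀ j, 1 ≤ d j)
    (hsum : 1 < ∑ j, (1 : ℝ) / d j) (E : (Fin (K + 1) → ℝ) → Set ℤ)
    (hE : ∀ l (x : Fin (K + 2) → ℕ), floorSum l (fun j => a j (x j)) ∈ E l) :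
    ∀ᵐ l : Fin (K + 1) → ℝ, 0 < upperBanach (E l) := by
  set D := ∏ j, d j
  have hD0 : 0 < D := Finset.prod_pos fun j _ => hd j
  set e : Fin (K + 2) → ℕ := fun j => D / d j
  have he (j : Fin (K + 2)) : e j * d j = D :=
    Nat.div_mul_cancel (Finset.dvd_prod_of_mem d (Finset.mem_univ j))
  have hD : D < ∑ j, e j := by
    have h1 : ∑ j, (1 : ℝ) / d j = ((∑ j, e j : ℕ) : ℝ) / D := by
      rw [Nat.cast_sum, Finset.sum_div]
      refine Finset.sum_congr rfl fun j _ => ?_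
      have hdj : (0 : ℝ) < d j := by exact_mod_cast hd j
      rw [div_eq_div_iff hdj.ne' (by positivity), one_mul]
      exact_mod_cast (he j).symm
    rw [h1, one_lt_div (by positivity)] at hsum
    exact_mod_cast hsum
  set q := 2 * ∑ j, e j - D
  have hbox (L : ℕ) : ∀ᵐ l : Fin (K + 1) → ℝ,
      (l ∈ {l : Fin (K + 1) → ℝ | ∀ i, l i ∈ Set.Icc (-((L : ℝ) + 1)) (L + 1)}) →
      ∃ N : ℕ, ∃ᶠ n : ℕ in atTop,
        (floorSumEnergy a (fun j => n ^ e j) l : ℝ≥0∞) / (n : ℝ≥0∞) ^ q ≤ N := by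
    obtain ⟨C', hC'⟩ := setLIntegral_floorSumEnergy_le hC ha he hD
      (show (0 : ℝ) < L + 1 by positivity)
    refine exists_frequently_le_of_setLIntegral_le ?_
      (fun n => (measurable_floorSumEnergy _ _).div_const _)
      (C := ENNReal.ofReal C') ENNReal.ofReal_ne_top fun n => ?_
    · rw [Set.ofPred_forall]
      exact MeasurableSet.iInter fun i => measurable_pi_apply i measurableSet_Icc
    · simp_rw [div_eq_mul_inv]
      rw [lintegral_mul_const _ (measurable_floorSumEnergy _ _), ← div_eq_mul_inv]
      refine ENNReal.div_le_of_le_mul ((hC' n).trans_eq ?_)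
      rw [ENNReal.ofReal_mul' (by positivity), ENNReal.ofReal_pow (Nat.cast_nonneg n),
        ENNReal.ofReal_natCast]
  filter_upwards [ae_all_iff.2 hbox] with l hl
  obtain ⟨L, hL⟩ := exists_nat_ge ‖l‖
  have hlL (i : Fin (K + 1)) : |l i| ≤ (L : ℝ) + 1 :=
    ((norm_le_pi_norm l i).trans hL).trans (by linarith)
  obtain ⟨N, hN⟩ := hl L fun i => abs_le.1 (hlL i)
  refine upperBanach_pos_of_frequently_energy_le hC ha he hD0.ne' hD.le hlL (by positivity)
    (N := N) ((hN.and_eventually (eventually_ge_atTop 1)).mono fun n ⟨hn, hn1⟩ => ?_) (hE l)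
  have h0 : (n : ℝ≥0∞) ^ q ≠ 0 := pow_ne_zero _ (by exact_mod_cast (by lia : n ≠ 0))
  rw [ENNReal.div_le_iff h0 (by finiteness)] at hn
  exact_mod_cast hn

/-- **Theorem 1.2, density part.** For polynomials `p_0, …, p_k ∈ ℤ[x]` of degrees
`d_i ≥ 1` with `1/d_0 + ⋯ + 1/d_k > 1` and `E_i = p_i(ℤ)`, for Lebesgue almost every
`(λ_1, …, λ_k) ∈ ℝ^k` the sum `E_0 + ⌊λ_1 E_1⌋ + ⋯ + ⌊λ_k E_k⌋` has positive
upper-Banach density. -/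
theorem marstrand_polynomial_density (k : ℕ) (p : Fin (k + 1) → Polynomial ℤ)
    (hdeg : ∀ i, 1 ≤ (p i).natDegree)
    (hsum : 1 < ∑ i : Fin (k + 1), (1 : ℝ) / ((p i).natDegree : ℝ)) :
    ∀ᵐ l : Fin k → ℝ ∂(volume : Measure (Fin k → ℝ)),
      0 < upperBanach
        {n : ℤ | ∃ a : Fin (k + 1) → ℤ, (∀ i, a i ∈ Set.range fun m : ℤ => (p i).eval m) ∧
          n = a 0 + ∑ i : Fin k, ⌊l i * ((a i.succ : ℤ) : ℝ)⌋} := by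
  rcases k with _ | K
  · have h1 : (1 : ℝ) ≤ (p 0).natDegree := by exact_mod_cast hdeg 0
    rw [Fin.sum_univ_one] at hsum
    exact absurd hsum (not_lt.2 ((div_le_one (by linarith)).2 h1))
  · choose m₀ C hC hsep hgrowth using fun i => (p i).exists_shift_separated (hdeg i)
    have hCle (j : Fin (K + 2)) : C j ≤ ∑ i, C i :=
      Finset.single_le_sum (fun i _ => (hC i).le) (Finset.mem_univ j)
    refine ae_upperBanach_pos (a := fun i m => (p i).eval ((m₀ i + m : ℕ) : ℤ))
      ((hC 0).trans_le (hCle 0))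
      (fun j => PolynomialLike.mono ⟨hsep j, hgrowth j⟩ (hCle j)) hdeg hsum _ fun l x => ?_
    exact ⟨fun i => (p i).eval ((m₀ i + x i : ℕ) : ℤ), fun i => ⟨_, rfl⟩, rfl⟩
end
end
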